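/- arXiv:1106.5635 — 2 statements merged into one kernel-verified Lean document; each statement's English description precedes it below -/
import Mathlib

section
/- Let B ⊂ ℝ² be a convex body and let C₁ ∪ ⋯ ∪ C_k = B be a partition of B into closed convex sets with pairwise disjoint interiors. Define r_B(C) = sup{h ≥ 0 : ∃ t ∈ ℝ², hB + t ⊆ C}. Then ∑_{i=1}^k r_B(C_i) ≥ 1. -/
/-- The inradius of `C` relative to the convex body `B`: the supremum of homothety
coefficients `h ≥ 0` such that a translate of `hB` fits inside `C`. -/
noncomputable def relInradius {d : ℕ} (B C : Set (EuclideanSpace ℝ (Fin d))) : ℝ :=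
  sSup {h : ℝ | 0 ≤ h ∧ ∃ t : EuclideanSpace ℝ (Fin d), (fun b => h • b + t) '' B ⊆ C}

namespace Kadets

open Set Filter Topology
open scoped RealInnerProductSpace

/-- The Euclidean plane. -/
abbrev E := EuclideanSpace ℝ (Fin 2)

/-- A convex partition of `Q`. -/
structure IsPart (Q : Set E) {k : ℕ} (C : Fin k → Set E) : Prop where
  closed : ∀ i, IsClosed (C i)
  convex : ∀ i, Convex ℝ (C i)
  cover : (⋃ i, C i) = Q
  disj : ∀ i j, i ≠ j → interior (C i) ∩ interior (C j) = ∅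

lemma IsPart.sub {Q : Set E} {k : ℕ} {C : Fin k → Set E} (h : IsPart Q C) (i : Fin k) :
    C i ⊆ Q := h.cover ▸ subset_iUnion C i

lemma IsPart.ex {Q : Set E} {k : ℕ} {C : Fin k → Set E} (h : IsPart Q C) {x : E} (hx : x ∈ Q) :
    ∃ i, x ∈ C i := by
  rw [← h.cover] at hx; exact mem_iUnion.1 hx

/-- The line `⟪n, ·⟫ = c` separates `A` and `B`. -/
def SepBy (A B : Set E) (n : E) (c : ℝ) : Prop :=
  n ≠ 0 ∧ (∀ y ∈ A, ⟪n, y⟫ ≤ c) ∧ ∀ y ∈ B, c ≤ ⟪n, y⟫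

lemma SepBy.symm {A B : Set E} {n : E} {c : ℝ} (h : SepBy A B n c) : SepBy B A (-n) (-c) := by
  refine ⟨neg_ne_zero.2 h.1, fun y hy => ?_, fun y hy => ?_⟩
  · rw [inner_neg_left]; linarith [h.2.2 y hy]
  · rw [inner_neg_left]; linarith [h.2.1 y hy]

lemma lt_of_int {A : Set E} {n a : E} {c : ℝ} (hn : n ≠ 0) (hA : ∀ y ∈ A, ⟪n, y⟫ ≤ c)
    (ha : a ∈ interior A) : ⟪n, a⟫ < c := by
  obtain ⟨r, hr, hb⟩ := Metric.isOpen_iff.1 isOpen_interior a ha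
  have hn' : 0 < ‖n‖ := norm_pos_iff.2 hn
  have h1 : a + (r / 2 / ‖n‖) • n ∈ A := by
    apply interior_subset; apply hb
    rw [Metric.mem_ball, dist_eq_norm, add_sub_cancel_left, norm_smul, Real.norm_eq_abs,
      abs_of_pos (by positivity)]
    field_simp; linarith
  have h2 := hA _ h1
  rw [inner_add_right, inner_smul_right, real_inner_self_eq_norm_sq] at h2
  have : 0 < r / 2 / ‖n‖ * ‖n‖ ^ 2 := by positivity
  linarith

lemma gt_of_int {A : Set E} {n a : E} {c : ℝ} (hn : n ≠ 0) (hA : ∀ y ∈ A, c ≤ ⟪n, y⟫)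
    (ha : a ∈ interior A) : c < ⟪n, a⟫ := by
  have := lt_of_int (n := -n) (c := -c) (neg_ne_zero.2 hn)
    (fun y hy => by rw [inner_neg_left]; linarith [hA y hy]) ha
  rw [inner_neg_left] at this; linarith

lemma SepBy.disj {A B : Set E} {n : E} {c : ℝ} (h : SepBy A B n c) :
    interior A ∩ interior B = ∅ := by
  ext a
  simp only [mem_inter_iff, mem_empty_iff_false, iff_false, not_and]
  intro ha hb
  linarith [lt_of_int h.1 h.2.1 ha, gt_of_int h.1 h.2.2 hb]

lemma sub_closure_int {A : Set E} (hA : Convex ℝ A) (hi : (interior A).Nonempty) :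
    A ⊆ closure (interior A) := by
  rw [hA.closure_interior_eq_closure_of_nonempty_interior hi]; exact subset_closure

lemma le_of_int {A : Set E} (hA : Convex ℝ A) (hi : (interior A).Nonempty) {n : E} {c : ℝ}
    (h : ∀ y ∈ interior A, ⟪n, y⟫ ≤ c) : ∀ y ∈ A, ⟪n, y⟫ ≤ c := by
  have : closure (interior A) ⊆ {y | ⟪n, y⟫ ≤ c} :=
    closure_minimal h (isClosed_le (by fun_prop) (by fun_prop))
  exact fun y hy => this (sub_closure_int hA hi hy)

lemma sep_exists {A B : Set E} (hA : Convex ℝ A) (hB : Convex ℝ B)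
    (hAi : (interior A).Nonempty) (hBi : (interior B).Nonempty)
    (hd : interior A ∩ interior B = ∅) : ∃ n c, SepBy A B n c := by
  obtain ⟨f, u, h1, h2⟩ := geometric_hahn_banach_open_open hA.interior isOpen_interior hB.interior
    isOpen_interior (disjoint_iff_inter_eq_empty.2 hd)
  set n := (InnerProductSpace.toDual ℝ E).symm f with hn
  have hf : ∀ y, ⟪n, y⟫ = f y := fun y => InnerProductSpace.toDual_symm_apply
  refine ⟨n, u, ?_, ?_, ?_⟩
  · rintro h0
    obtain ⟨a, ha⟩ := hAi
    obtain ⟨b, hb⟩ := hBi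
    have e1 := h1 a ha
    have e2 := h2 b hb
    rw [← hf, h0, inner_zero_left] at e1 e2
    linarith
  · exact le_of_int hA hAi (fun y hy => by rw [hf]; exact (h1 y hy).le)
  · intro y hy
    have := le_of_int (n := -n) (c := -u) hB hBi
      (fun y hy => by rw [inner_neg_left, hf]; linarith [h2 y hy]) y hy
    rw [inner_neg_left] at this; linarith

lemma sep_strict {A B : Set E} (hA : Convex ℝ A) (hB : Convex ℝ B)
    (hAc : IsCompact A) (hBc : IsClosed B) (hAi : A.Nonempty) (hBi : B.Nonempty)
    (hd : A ∩ B = ∅) : ∃ (n : E) (c : ℝ), n ≠ 0 ∧ (∀ y ∈ A, ⟪n, y⟫ < c) ∧ ∀ y ∈ B, c < ⟪n, y⟫ := by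
  obtain ⟨f, u, v, h1, huv, h2⟩ := geometric_hahn_banach_compact_closed hA hAc hB hBc
    (disjoint_iff_inter_eq_empty.2 hd)
  set n := (InnerProductSpace.toDual ℝ E).symm f with hn
  have hf : ∀ y, ⟪n, y⟫ = f y := fun y => InnerProductSpace.toDual_symm_apply
  refine ⟨n, u, ?_, fun y hy => by rw [hf]; exact h1 y hy,
    fun y hy => by rw [hf]; exact huv.trans (h2 y hy)⟩
  rintro h0
  obtain ⟨a, ha⟩ := hAi
  obtain ⟨b, hb⟩ := hBi
  have e1 := h1 a ha
  have e2 := h2 b hb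
  rw [← hf, h0, inner_zero_left] at e1 e2
  linarith

/-- A supporting line at a boundary point. -/
lemma support {Q : Set E} (hQ : Convex ℝ Q) (hi : (interior Q).Nonempty) {x : E}
    (hx : x ∉ interior Q) : ∃ n : E, n ≠ 0 ∧ ∀ y ∈ Q, ⟪n, y - x⟫ ≤ 0 := by
  obtain ⟨f, h1⟩ := geometric_hahn_banach_open_point hQ.interior isOpen_interior hx
  set n := (InnerProductSpace.toDual ℝ E).symm f with hn
  have hf : ∀ y, ⟪n, y⟫ = f y := fun y => InnerProductSpace.toDual_symm_apply
  refine ⟨n, ?_, ?_⟩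
  · rintro h0
    obtain ⟨a, ha⟩ := hi
    have e1 := h1 a ha
    rw [← hf, ← hf, h0, inner_zero_left, inner_zero_left] at e1
    linarith
  · intro y hy
    rw [inner_sub_right, sub_nonpos]
    exact le_of_int hQ hi (fun y hy => by rw [hf, hf]; exact (h1 y hy).le) y hy

/-- Separating half-planes cut out the parts of the partition. -/
lemma refine_sep {Q : Set E} (hQ : Convex ℝ Q) {k : ℕ} {C : Fin k → Set E} (hC : IsPart Q C)
    (hi : ∀ i, (interior (C i)).Nonempty) {n : Fin k → Fin k → E} {c : Fin k → Fin k → ℝ}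
    (hs : ∀ i j, i ≠ j → SepBy (C i) (C j) (n i j) (c i j)) (i : Fin k) {y : E} (hy : y ∈ Q)
    (hyi : ∀ j, j ≠ i → ⟪n i j, y⟫ ≤ c i j) : y ∈ C i := by
  obtain ⟨a, ha⟩ := hi i
  have key : ∀ s ∈ Ioo (0 : ℝ) 1, (1 - s) • y + s • a ∈ C i := by
    intro s hs'
    have hz : (1 - s) • y + s • a ∈ Q :=
      hQ hy (hC.sub i (interior_subset ha)) (by linarith [hs'.2]) hs'.1.le (by ring)
    obtain ⟨l, hl⟩ := hC.ex hz
    by_cases hli : l = i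
    · exact hli ▸ hl
    · exfalso
      have h1 := (hs i l (Ne.symm hli)).2.2 _ hl
      have h2 := lt_of_int (hs i l (Ne.symm hli)).1 (hs i l (Ne.symm hli)).2.1 ha
      have h3 := hyi l hli
      rw [inner_add_right, inner_smul_right, inner_smul_right] at h1
      nlinarith [hs'.1, hs'.2, mul_lt_mul_of_pos_left h2 hs'.1,
        mul_le_mul_of_nonneg_left h3 (by linarith [hs'.2] : (0:ℝ) ≤ 1 - s)]
  have ht : Tendsto (fun s : ℝ => (1 - s) • y + s • a) (𝓝[>] 0) (𝓝 y) := by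
    have : Continuous (fun s : ℝ => (1 - s) • y + s • a) := by fun_prop
    have := this.tendsto 0
    simp only [sub_zero, one_smul, zero_smul, add_zero] at this
    exact this.mono_left nhdsWithin_le_nhds
  refine (hC.closed i).mem_of_tendsto ht ?_
  filter_upwards [Ioo_mem_nhdsGT (zero_lt_one' ℝ)] with s hs' using key s hs'

lemma inner_two (x y : E) : ⟪x, y⟫ = x 0 * y 0 + x 1 * y 1 := by
  simp [PiLp.inner_apply, Fin.sum_univ_two, mul_comm]

/-- Two functionals on the plane vanishing on the same nonzero vector are proportional. -/
lemma prop_two {n m d a y : E} (hd : d ≠ 0) (hn : ⟪n, d⟫ = 0) (hm : ⟪m, d⟫ = 0)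
    (hna : ⟪n, a⟫ < 0) (hma : ⟪m, a⟫ < 0) (hy : ⟪m, y⟫ ≤ 0) : ⟪n, y⟫ ≤ 0 := by
  have hcross : n 0 * m 1 - n 1 * m 0 = 0 := by
    rw [inner_two] at hn hm
    have h0 : (n 0 * m 1 - n 1 * m 0) * d 0 = 0 := by linear_combination m 1 * hn - n 1 * hm
    have h1 : (n 0 * m 1 - n 1 * m 0) * d 1 = 0 := by linear_combination n 0 * hm - m 0 * hn
    by_contra hne
    apply hd
    ext i
    fin_cases i
    · simpa [hne] using h0
    · simpa [hne] using h1
  have key : ⟪m, y⟫ * ⟪n, a⟫ = ⟪n, y⟫ * ⟪m, a⟫ := by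
    simp only [inner_two]
    linear_combination (y 1 * a 0 - y 0 * a 1) * hcross
  by_contra! hpos
  nlinarith [mul_nonneg_of_nonpos_of_nonpos hy hna.le, mul_neg_of_pos_of_neg hpos hma]

lemma first_piece {k : ℕ} {C : Fin k → Set E} (S : Finset (Fin k)) (hS : S.Nonempty) {x ν : E}
    (hν : ν ≠ 0) (hx : ∀ i ∈ S, x ∈ C i) (hi : ∀ i, (interior (C i)).Nonempty)
    (hsup : ∀ i ∈ S, ∀ y ∈ C i, ⟪ν, y - x⟫ ≤ 0)
    (hsep : ∀ i j, i ≠ j → ∃ n c, SepBy (C i) (C j) n c) :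
    ∃ w ∈ S, ∃ n : E, n ≠ 0 ∧ (∀ y ∈ C w, ⟪n, y - x⟫ ≤ 0) ∧
      ∀ j ∈ S, j ≠ w → ∀ y ∈ C j, 0 ≤ ⟪n, y - x⟫ := by
  choose v hv using hi
  set b : E → ℝ := fun y => -⟪ν, y - x⟫ with hb
  set a : E → ℝ := fun y => ν 0 * (y 1 - x 1) - ν 1 * (y 0 - x 0) with ha
  have hbpos : ∀ i ∈ S, 0 < b (v i) := by
    intro i hiS
    have := lt_of_int (c := ⟪ν, x⟫) hν (fun y hy => by
      have := hsup i hiS y hy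
      rw [inner_sub_right] at this; linarith) (hv i)
    simp only [hb, inner_sub_right]; linarith
  obtain ⟨w, hwS, hw⟩ := S.exists_min_image (fun i => a (v i) / b (v i)) hS
  by_cases hne : (S.erase w).Nonempty
  swap
  · refine ⟨w, hwS, ν, hν, hsup w hwS, fun j hj hjw => ?_⟩
    exact absurd ⟨j, Finset.mem_erase.2 ⟨hjw, hj⟩⟩ hne
  have hN : 0 < ν 0 ^ 2 + ν 1 ^ 2 := by
    by_contra hcon
    have h0 : ν 0 = 0 := by nlinarith [sq_nonneg (ν 0), sq_nonneg (ν 1)]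
    have h1 : ν 1 = 0 := by nlinarith [sq_nonneg (ν 0), sq_nonneg (ν 1)]
    apply hν
    ext i
    fin_cases i
    · simpa using h0
    · simpa using h1
  have hex : ∀ j, ∃ n : E, j ∈ S.erase w → (n ≠ 0 ∧ (∀ y ∈ C w, ⟪n, y - x⟫ ≤ 0) ∧
      ∀ y ∈ C j, 0 ≤ ⟪n, y - x⟫) := by
    intro j
    by_cases hj : j ∈ S.erase w
    · obtain ⟨hjw, hjS⟩ := Finset.mem_erase.1 hj
      obtain ⟨n, c, h1, h2, h3⟩ := hsep w j (Ne.symm hjw)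
      have e1 := h2 x (hx w hwS)
      have e2 := h3 x (hx j hjS)
      refine ⟨n, fun _ => ⟨h1, fun y hy => ?_, fun y hy => ?_⟩⟩
      · rw [inner_sub_right]; linarith [h2 y hy]
      · rw [inner_sub_right]; linarith [h3 y hy]
    · exact ⟨0, fun h => absurd h hj⟩
  choose n hn using hex
  set α : Fin k → ℝ := fun j => n j 1 * ν 0 - n j 0 * ν 1 with hα
  set β : Fin k → ℝ := fun j => -(n j 0 * ν 0 + n j 1 * ν 1) with hβ
  have hexp : ∀ j y, ⟪n j, y - x⟫ * (ν 0 ^ 2 + ν 1 ^ 2) = α j * a y + β j * b y := by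
    intro j y
    simp only [hα, hβ, ha, hb, inner_two, PiLp.sub_apply]
    ring
  have hαpos : ∀ j ∈ S.erase w, 0 < α j := by
    intro j hj
    obtain ⟨hjw, hjS⟩ := Finset.mem_erase.1 hj
    obtain ⟨h1, h2, h3⟩ := hn j hj
    have e1 : ⟪n j, v w - x⟫ < 0 := by
      have := lt_of_int (c := ⟪n j, x⟫) h1 (fun y hy => by
        have := h2 y hy; rw [inner_sub_right] at this; linarith) (hv w)
      rw [inner_sub_right]; linarith
    have e2 : 0 < ⟪n j, v j - x⟫ := by
      have := gt_of_int (c := ⟪n j, x⟫) h1 (fun y hy => by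
        have := h3 y hy; rw [inner_sub_right] at this; linarith) (hv j)
      rw [inner_sub_right]; linarith
    have f1 : α j * a (v w) + β j * b (v w) < 0 := by
      rw [← hexp]; exact mul_neg_of_neg_of_pos e1 hN
    have f2 : 0 < α j * a (v j) + β j * b (v j) := by
      rw [← hexp]; exact mul_pos e2 hN
    have bw := hbpos w hwS
    have bj := hbpos j hjS
    have hs := hw j hjS
    have g1 : α j * (a (v w) / b (v w)) + β j < 0 := by
      have : α j * (a (v w) / b (v w)) + β j = (α j * a (v w) + β j * b (v w)) / b (v w) := by
        field_simp
      rw [this]; exact div_neg_of_neg_of_pos f1 bw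
    have g2 : 0 < α j * (a (v j) / b (v j)) + β j := by
      have : α j * (a (v j) / b (v j)) + β j = (α j * a (v j) + β j * b (v j)) / b (v j) := by
        field_simp
      rw [this]; exact div_pos f2 bj
    by_contra! hcon
    nlinarith [mul_le_mul_of_nonpos_left hs hcon]
  obtain ⟨l, hl, hlmin⟩ := (S.erase w).exists_min_image (fun j => -β j / α j) hne
  refine ⟨w, hwS, n l, (hn l hl).1, (hn l hl).2.1, fun j hj hjw y hy => ?_⟩
  have hj' : j ∈ S.erase w := Finset.mem_erase.2 ⟨hjw, hj⟩
  have h1 : 0 ≤ α j * a y + β j * b y := by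
    rw [← hexp]; exact mul_nonneg ((hn j hj').2.2 y hy) hN.le
  have hby : 0 ≤ b y := by simp only [hb]; linarith [hsup j hj y hy]
  have h2 : -β j / α j * b y ≤ a y := by
    rw [div_mul_eq_mul_div, div_le_iff₀ (hαpos j hj')]; linarith
  have h3 : -β l / α l * b y ≤ a y := (mul_le_mul_of_nonneg_right (hlmin j hj') hby).trans h2
  rw [div_mul_eq_mul_div, div_le_iff₀ (hαpos l hl)] at h3
  have h4 : 0 ≤ ⟪n l, y - x⟫ * (ν 0 ^ 2 + ν 1 ^ 2) := by rw [hexp]; linarith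
  exact nonneg_of_mul_nonneg_left h4 hN

/-- Consistent separating lines through a boundary point. -/
lemma fan {k : ℕ} {C : Fin k → Set E} {x ν : E}
    (hν : ν ≠ 0) (hi : ∀ i, (interior (C i)).Nonempty)
    (hsep : ∀ i j, i ≠ j → ∃ n c, SepBy (C i) (C j) n c) (S : Finset (Fin k)) :
    (∀ i ∈ S, x ∈ C i) → (∀ i ∈ S, ∀ y ∈ C i, ⟪ν, y - x⟫ ≤ 0) →
    ∃ M : Fin k → Fin k → E, (∀ i ∈ S, ∀ j ∈ S, i ≠ j → M i j ≠ 0 ∧ M j i = -M i j ∧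
      ∀ y ∈ C i, ⟪M i j, y - x⟫ ≤ 0) ∧
      (S.Nonempty → ∀ y, ∃ i ∈ S, ∀ j ∈ S, j ≠ i → ⟪M i j, y⟫ ≤ 0) := by
  induction S using Finset.strongInduction with
  | H S ih =>
    intro hx hsup
    by_cases hS : S.Nonempty
    swap
    · refine ⟨fun _ _ => 0, fun i hiS => absurd ⟨i, hiS⟩ hS, fun h => absurd h hS⟩
    obtain ⟨w, hw, n, hn0, hnw, hnj⟩ := first_piece S hS hν hx hi hsup hsep
    obtain ⟨M, hM, hwin⟩ := ih (S.erase w) (Finset.erase_ssubset hw)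
      (fun i h => hx i (Finset.mem_of_mem_erase h)) (fun i h => hsup i (Finset.mem_of_mem_erase h))
    refine ⟨fun i j => if i = w then n else if j = w then -n else M i j, ?_, ?_⟩
    · intro i hiS j hjS hij
      by_cases hiw : i = w
      · have hjw : j ≠ w := fun h => hij (hiw.trans h.symm)
        simp only [hiw, hjw, if_true, if_false]
        exact ⟨hn0, trivial, hnw⟩
      · by_cases hjw : j = w
        · simp only [hiw, hjw, if_true, if_false, neg_neg]
          refine ⟨neg_ne_zero.2 hn0, trivial, fun y hy => ?_⟩
          rw [inner_neg_left]; linarith [hnj i hiS hiw y hy]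
        · simp only [hiw, hjw, if_false]
          exact hM i (Finset.mem_erase.2 ⟨hiw, hiS⟩) j (Finset.mem_erase.2 ⟨hjw, hjS⟩) hij
    · intro _ y
      by_cases hy : ⟪n, y⟫ ≤ 0
      · exact ⟨w, hw, fun j _ _ => by simpa using hy⟩
      · by_cases hne : (S.erase w).Nonempty
        · obtain ⟨i, hiS, hij⟩ := hwin hne y
          obtain ⟨hiw, hiS'⟩ := Finset.mem_erase.1 hiS
          refine ⟨i, hiS', fun j hj hji => ?_⟩
          by_cases hjw : j = w
          · simp only [hiw, hjw, if_true, if_false, inner_neg_left]; linarith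
          · simp only [hiw, hjw, if_false]
            exact hij j (Finset.mem_erase.2 ⟨hjw, hj⟩) hji
        · refine ⟨w, hw, fun j hj hjw => ?_⟩
          exact absurd ⟨j, Finset.mem_erase.2 ⟨hjw, hj⟩⟩ hne

/-- Antisymmetric choice. -/
lemma antisymm_choice {k : ℕ} (P : Fin k → Fin k → E → ℝ → Prop)
    (hsymm : ∀ i j n c, i ≠ j → P i j n c → P j i (-n) (-c))
    (hex : ∀ i j, i ≠ j → ∃ n c, P i j n c) :
    ∃ (n : Fin k → Fin k → E) (c : Fin k → Fin k → ℝ), (∀ i j, n j i = -n i j) ∧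
      (∀ i j, c j i = -c i j) ∧ ∀ i j, i ≠ j → P i j (n i j) (c i j) := by
  have : ∀ i j, ∃ n c, i ≠ j → P i j n c := by
    intro i j
    by_cases h : i = j
    · exact ⟨0, 0, fun h' => absurd h h'⟩
    · obtain ⟨n, c, hh⟩ := hex i j h
      exact ⟨n, c, fun _ => hh⟩
  choose n c hnc using this
  refine ⟨fun i j => if i < j then n i j else if j < i then -n j i else 0,
    fun i j => if i < j then c i j else if j < i then -c j i else 0, ?_, ?_, ?_⟩
  · intro i j
    rcases lt_trichotomy i j with h | h | h
    · simp [h, h.not_gt]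
    · simp [h]
    · simp [h, h.not_gt]
  · intro i j
    rcases lt_trichotomy i j with h | h | h
    · simp [h, h.not_gt]
    · simp [h]
    · simp [h, h.not_gt]
  · intro i j hij
    rcases lt_or_gt_of_ne hij with h | h
    · simpa [h] using hnc i j hij
    · simpa [h, h.not_gt] using hsymm j i _ _ hij.symm (hnc j i hij.symm)

lemma adjacent {Q : Set E} (hQ : Convex ℝ Q) {k : ℕ} {C : Fin k → Set E} (hC : IsPart Q C)
    {i : Fin k} {n x z b : E} {c : ℝ} (hn : ∀ y ∈ C i, ⟪n, y⟫ ≤ c) (hx : x ∈ C i) (hz : z ∈ C i)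
    (hxz : z ≠ x) (hxc : ⟪n, x⟫ = c) (hzc : ⟪n, z⟫ = c) (hb : b ∈ Q) (hbc : c < ⟪n, b⟫) :
    ∃ l, l ≠ i ∧ x ∈ C l ∧ ∃ x', x' ∈ C i ∧ x' ∈ C l ∧ x' ≠ x ∧ ⟪n, x'⟫ = c := by
  have hcl : IsClosed (⋃ l, ⋃ (_ : l ≠ i), C l) :=
    isClosed_iUnion_of_finite fun l => isClosed_iUnion_of_finite fun _ => hC.closed l
  have hxt : ∀ t ∈ Ioo (0 : ℝ) 1, (1 - t) • x + t • z ∈ C i := fun t ht =>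
    hC.convex i hx hz (by linarith [ht.2]) ht.1.le (by ring)
  have hxtc : ∀ t : ℝ, ⟪n, (1 - t) • x + t • z⟫ = c := by
    intro t
    rw [inner_add_right, inner_smul_right, inner_smul_right, hxc, hzc]; ring
  have h1 : ∀ t ∈ Ioo (0 : ℝ) 1, (1 - t) • x + t • z ∈ ⋃ l, ⋃ (_ : l ≠ i), C l := by
    intro t ht
    set p := (1 - t) • x + t • z with hp
    have hlim : Tendsto (fun s : ℝ => (1 - s) • p + s • b) (𝓝[>] 0) (𝓝 p) := by
      have : Continuous (fun s : ℝ => (1 - s) • p + s • b) := by fun_prop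
      have := this.tendsto 0
      simp only [sub_zero, one_smul, zero_smul, add_zero] at this
      exact this.mono_left nhdsWithin_le_nhds
    refine hcl.mem_of_tendsto hlim ?_
    filter_upwards [Ioo_mem_nhdsGT (zero_lt_one' ℝ)] with s hs
    have hq : (1 - s) • p + s • b ∈ Q :=
      hQ (hC.sub i (hxt t ht)) hb (by linarith [hs.2]) hs.1.le (by ring)
    obtain ⟨l, hl⟩ := hC.ex hq
    refine mem_iUnion₂.2 ⟨l, ?_, hl⟩
    rintro rfl
    have := hn _ hl
    rw [inner_add_right, inner_smul_right, inner_smul_right, hxtc t] at this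
    nlinarith [mul_lt_mul_of_pos_left hbc hs.1]
  have hlim : Tendsto (fun t : ℝ => (1 - t) • x + t • z) (𝓝[>] 0) (𝓝 x) := by
    have : Continuous (fun t : ℝ => (1 - t) • x + t • z) := by fun_prop
    have := this.tendsto 0
    simp only [sub_zero, one_smul, zero_smul, add_zero] at this
    exact this.mono_left nhdsWithin_le_nhds
  have h2 : ∀ᶠ y in 𝓝 x, ∀ l, y ∈ C l → x ∈ C l := by
    rw [eventually_all]
    intro l
    by_cases hl : x ∈ C l
    · exact Eventually.of_forall fun y _ => hl
    · filter_upwards [(hC.closed l).isOpen_compl.mem_nhds hl] with y hy hy'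
      exact absurd hy' hy
  obtain ⟨t, ht, ht2⟩ := ((hlim.eventually h2).and
    (Ioo_mem_nhdsGT (zero_lt_one' ℝ))).exists
  obtain ⟨l, hl, hxl⟩ := mem_iUnion₂.1 (h1 t ht2)
  refine ⟨l, hl, ht l hxl, _, hxt t ht2, hxl, ?_, hxtc t⟩
  intro he
  have : t • (z - x) = 0 := by
    rw [← sub_eq_zero] at he
    rw [← he, sub_smul, one_smul, smul_sub]; abel
  rcases smul_eq_zero.1 this with h | h
  · exact ht2.1.ne' h
  · exact hxz (sub_eq_zero.1 h)

lemma extension {Q : Set E} (hQ : Convex ℝ Q) (hQc : IsCompact Q) (hQi : (interior Q).Nonempty)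
    {k : ℕ} {C : Fin k → Set E} (hC : IsPart Q C) (hi : ∀ i, (interior (C i)).Nonempty) :
    ∃ (n : Fin k → Fin k → E) (c : Fin k → Fin k → ℝ),
      (∀ i j, i ≠ j → SepBy (C i) (C j) (n i j) (c i j)) ∧
      (∀ i j, n j i = -n i j) ∧ (∀ i j, c j i = -c i j) ∧
      ∀ x ∈ Q, ∀ᶠ y in 𝓝 x, ∃ i, ∀ j, j ≠ i → ⟪n i j, y⟫ ≤ c i j := by
  classical
  have hsep : ∀ i j, i ≠ j → ∃ n c, SepBy (C i) (C j) n c := fun i j hij =>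
    sep_exists (hC.convex i) (hC.convex j) (hi i) (hi j) (hC.disj i j hij)
  have hMex : ∀ x, ∃ M : Fin k → Fin k → E, x ∈ Q → x ∉ interior Q →
      (∀ i j, x ∈ C i → x ∈ C j → i ≠ j → M i j ≠ 0 ∧ M j i = -M i j ∧
      ∀ y ∈ C i, ⟪M i j, y - x⟫ ≤ 0) ∧
      (∀ y, ∃ i, x ∈ C i ∧ ∀ j, x ∈ C j → j ≠ i → ⟪M i j, y⟫ ≤ 0) := by
    intro x
    by_cases hx : x ∈ Q ∧ x ∉ interior Q
    swap
    · exact ⟨fun _ _ => 0, fun h1 h2 => absurd ⟨h1, h2⟩ hx⟩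
    obtain ⟨ν, hν, hsup⟩ := support hQ hQi hx.2
    obtain ⟨M, h1, h2⟩ := fan (x := x) hν hi hsep (Finset.univ.filter fun i => x ∈ C i)
      (fun i h => (Finset.mem_filter.1 h).2) (fun i _ y hy => hsup y (hC.sub i hy))
    refine ⟨M, fun _ _ => ⟨fun i j hxi hxj hij => ?_, fun y => ?_⟩⟩
    · exact h1 i (by simp [hxi]) j (by simp [hxj]) hij
    · obtain ⟨i0, hi0⟩ := hC.ex hx.1
      obtain ⟨i, hiS, hw⟩ := h2 ⟨i0, by simp [hi0]⟩ y
      exact ⟨i, (Finset.mem_filter.1 hiS).2, fun j hj hji => hw j (by simp [hj]) hji⟩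
  choose M hM using hMex
  obtain ⟨n, c, hna, hca, hP⟩ := antisymm_choice (k := k)
    (fun i j n c => SepBy (C i) (C j) n c ∧
      (C i ∩ C j = ∅ → (∀ y ∈ C i, ⟪n, y⟫ < c) ∧ ∀ y ∈ C j, c < ⟪n, y⟫) ∧
      ∀ x ∈ Q, x ∉ interior Q → C i ∩ C j = {x} → n = M x i j ∧ c = ⟪n, x⟫) (by
    rintro i j n c hij ⟨h1, h2, h3⟩
    refine ⟨h1.symm, fun he => ?_, fun x hx hx' he => ?_⟩
    · obtain ⟨e1, e2⟩ := h2 (by rw [inter_comm]; exact he)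
      refine ⟨fun y hy => ?_, fun y hy => ?_⟩
      · rw [inner_neg_left]; linarith [e2 y hy]
      · rw [inner_neg_left]; linarith [e1 y hy]
    · rw [inter_comm] at he
      obtain ⟨e1, e2⟩ := h3 x hx hx' he
      have hm : x ∈ C i ∩ C j := by rw [he]; rfl
      rw [((hM x hx hx').1 i j hm.1 hm.2 hij).2.1, ← e1]
      exact ⟨rfl, by rw [inner_neg_left, e2]⟩) (by
    intro i j hij
    by_cases he : C i ∩ C j = ∅
    · obtain ⟨n, c, hn, h1, h2⟩ := sep_strict (hC.convex i) (hC.convex j)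
        (hQc.of_isClosed_subset (hC.closed i) (hC.sub i)) (hC.closed j)
        ((hi i).mono interior_subset) ((hi j).mono interior_subset) he
      refine ⟨n, c, ⟨hn, fun y hy => (h1 y hy).le, fun y hy => (h2 y hy).le⟩,
        fun _ => ⟨h1, h2⟩, fun x _ _ hx => ?_⟩
      rw [he] at hx
      exact absurd hx.symm (singleton_ne_empty x)
    by_cases hx : ∃ x ∈ Q, x ∉ interior Q ∧ C i ∩ C j = {x}
    · obtain ⟨x, hxQ, hxi, hxe⟩ := hx
      have hm : x ∈ C i ∩ C j := by rw [hxe]; rfl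
      obtain ⟨m1, m2, m3⟩ := (hM x hxQ hxi).1 i j hm.1 hm.2 hij
      obtain ⟨-, -, m4⟩ := (hM x hxQ hxi).1 j i hm.2 hm.1 hij.symm
      refine ⟨M x i j, ⟪M x i j, x⟫, ⟨m1, fun y hy => ?_, fun y hy => ?_⟩,
        fun h => absurd h he, fun x' _ _ hx' => ?_⟩
      · have := m3 y hy; rw [inner_sub_right] at this; linarith
      · have := m4 y hy; rw [m2, inner_neg_left, inner_sub_right] at this; linarith
      · have : x = x' := singleton_injective (hxe.symm.trans hx')
        subst this
        exact ⟨rfl, rfl⟩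
    · obtain ⟨n, c, h⟩ := hsep i j hij
      exact ⟨n, c, h, fun h => absurd h he, fun x h1 h2 h3 => absurd ⟨x, h1, h2, h3⟩ hx⟩)
  refine ⟨n, c, fun i j hij => (hP i j hij).1, hna, hca, fun x hx => ?_⟩
  by_cases hxi : x ∈ interior Q
  · filter_upwards [isOpen_interior.mem_nhds hxi] with y hy
    obtain ⟨i, hyi⟩ := hC.ex (interior_subset hy)
    exact ⟨i, fun j hj => (hP i j hj.symm).1.2.1 y hyi⟩
  have hev : ∀ᶠ y in 𝓝 x, ∀ i j, ⟪n i j, x⟫ < c i j → ⟪n i j, y⟫ ≤ c i j := by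
    simp only [eventually_all]
    intro i j hlt
    have hcont : Continuous fun y : E => ⟪n i j, y⟫ := by fun_prop
    filter_upwards [hcont.continuousAt.eventually_lt continuousAt_const hlt] with y hy using hy.le
  filter_upwards [hev] with y hy
  obtain ⟨hM1, hM2⟩ := hM x hx hxi
  obtain ⟨i, hxCi, hwin⟩ := hM2 (y - x)
  refine ⟨i, fun j hji => ?_⟩
  obtain ⟨hs, hstrict, hpt⟩ := hP i j hji.symm
  rcases (hs.2.1 x hxCi).lt_or_eq with hlt | heq
  · exact hy i j hlt
  suffices h : ⟪n i j, y - x⟫ ≤ 0 by rw [inner_sub_right] at h; linarith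
  by_cases he : C i ∩ C j = ∅
  · exact absurd heq ((hstrict he).1 x hxCi).ne
  by_cases hsing : C i ∩ C j = {x}
  · have hm : x ∈ C i ∩ C j := by rw [hsing]; rfl
    rw [(hpt x hx hxi hsing).1]
    exact hwin j hm.2 hji
  obtain ⟨z, hz, hzx⟩ : ∃ z ∈ C i ∩ C j, z ≠ x := by
    by_contra! hcon
    obtain ⟨z, hz⟩ := nonempty_iff_ne_empty.2 he
    apply hsing
    ext u
    refine ⟨fun hu => hcon u hu, fun hu => ?_⟩
    rw [mem_singleton_iff] at hu
    rw [hu, ← hcon z hz]; exact hz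
  obtain ⟨b, hb⟩ := hi j
  obtain ⟨a, ha⟩ := hi i
  obtain ⟨l, hli, hxl, x', hx'i, hx'l, hx'x, hx'c⟩ := adjacent hQ hC hs.2.1 hxCi hz.1 hzx heq
    (le_antisymm (hs.2.1 z hz.1) (hs.2.2 z hz.2)) (hC.sub j (interior_subset hb))
    (gt_of_int hs.1 hs.2.2 hb)
  obtain ⟨m1, m2, m3⟩ := hM1 i l hxCi hxl hli.symm
  obtain ⟨-, -, m4⟩ := hM1 l i hxl hxCi hli
  refine prop_two (m := M x i l) (d := x' - x) (a := a - x) (sub_ne_zero.2 hx'x) ?_ ?_ ?_ ?_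
    (hwin l hxl hli)
  · rw [inner_sub_right]; linarith
  · refine le_antisymm (m3 x' hx'i) ?_
    have := m4 x' hx'l
    rw [m2, inner_neg_left] at this; linarith
  · have := lt_of_int hs.1 hs.2.1 ha
    rw [inner_sub_right]; linarith
  · have := lt_of_int (c := ⟪M x i l, x⟫) m1 (fun y hy => by
      have := m3 y hy; rw [inner_sub_right] at this; linarith) ha
    rw [inner_sub_right]; linarith

/-! ### Basic facts about the relative inradius -/

/-- Feasible homothety coefficients. -/
def Feas (Q C : Set E) (h : ℝ) : Prop := 0 ≤ h ∧ ∃ t : E, ∀ b ∈ Q, h • b + t ∈ C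

lemma relInradius_eq (Q C : Set E) : relInradius Q C = sSup {h | Feas Q C h} := by
  unfold relInradius Feas
  simp only [image_subset_iff]
  rfl

lemma Feas.le_one {Q C : Set E} (hQc : IsCompact Q) (hQi : (interior Q).Nonempty) (hCQ : C ⊆ Q)
    {h : ℝ} (hf : Feas Q C h) : h ≤ 1 := by
  obtain ⟨h0, t, ht⟩ := hf
  obtain ⟨p, hp⟩ := hQi
  obtain ⟨r, hr, hb⟩ := Metric.isOpen_iff.1 isOpen_interior p hp
  have hd : 0 < Metric.diam Q := by
    obtain ⟨v, hv⟩ := exists_norm_eq (E := E) (c := r / 2) (by positivity)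
    have h1 : p + v ∈ Q := interior_subset (hb (by
      rw [Metric.mem_ball, dist_eq_norm, add_sub_cancel_left, hv]; linarith))
    have := Metric.dist_le_diam_of_mem hQc.isBounded h1 (interior_subset hp)
    rw [dist_eq_norm, add_sub_cancel_left, hv] at this
    linarith
  have hkey : Metric.diam Q ≤ Metric.diam Q / h ∨ h = 0 := by
    rcases h0.eq_or_lt with h0 | h0
    · exact Or.inr h0.symm
    left
    refine Metric.diam_le_of_forall_dist_le (by positivity) fun x hx y hy => ?_
    have := Metric.dist_le_diam_of_mem hQc.isBounded (hCQ (ht x hx)) (hCQ (ht y hy))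
    rw [dist_add_right, dist_smul₀, Real.norm_eq_abs, abs_of_pos h0] at this
    rw [le_div_iff₀ h0]; linarith
  rcases hkey with hk | hk
  · by_contra hc
    push Not at hc
    rw [le_div_iff₀ (by linarith)] at hk
    nlinarith
  · linarith

lemma bdd {Q C : Set E} (hQc : IsCompact Q) (hQi : (interior Q).Nonempty) (hCQ : C ⊆ Q) :
    BddAbove {h | Feas Q C h} := ⟨1, fun _ hh => Feas.le_one hQc hQi hCQ hh⟩

lemma Feas.le_r {Q C : Set E} (hQc : IsCompact Q) (hQi : (interior Q).Nonempty) (hCQ : C ⊆ Q)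
    {h : ℝ} (hf : Feas Q C h) : h ≤ relInradius Q C := by
  rw [relInradius_eq]; exact le_csSup (bdd hQc hQi hCQ) hf

lemma r_nonneg (Q C : Set E) : 0 ≤ relInradius Q C := by
  rw [relInradius_eq]; exact Real.sSup_nonneg fun _ h => h.1

lemma feas_zero {Q C : Set E} (hC : C.Nonempty) : Feas Q C 0 := by
  obtain ⟨t, ht⟩ := hC
  exact ⟨le_rfl, t, fun b _ => by simpa using ht⟩

lemma one_le_r {Q : Set E} (hQc : IsCompact Q) (hQi : (interior Q).Nonempty) :
    1 ≤ relInradius Q Q :=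
  Feas.le_r hQc hQi Subset.rfl ⟨zero_le_one, 0, fun b hb => by simpa using hb⟩

lemma exists_feas {Q C : Set E} {y : ℝ} (hy0 : 0 ≤ y) (hy : y < relInradius Q C) :
    ∃ h, Feas Q C h ∧ y < h := by
  rw [relInradius_eq] at hy
  have hne : {h | Feas Q C h}.Nonempty := by
    by_contra hc
    rw [not_nonempty_iff_eq_empty.1 hc, Real.sSup_empty] at hy
    linarith
  obtain ⟨h, hh, hl⟩ := exists_lt_of_lt_csSup hne hy
  exact ⟨h, hh, hl⟩

lemma exists_feas' {Q C : Set E} (hC : C.Nonempty) {ε : ℝ} (hε : 0 < ε) :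
    ∃ h, Feas Q C h ∧ relInradius Q C - ε < h := by
  rw [relInradius_eq]
  obtain ⟨h, hh, hl⟩ := exists_lt_of_lt_csSup (s := {h | Feas Q C h})
    ⟨0, feas_zero hC⟩ (b := sSup {h | Feas Q C h} - ε) (by linarith)
  exact ⟨h, hh, hl⟩

/-- Concavity of the relative inradius. -/
lemma r_concave {Q C C1 C2 : Set E} (hQc : IsCompact Q) (hQi : (interior Q).Nonempty)
    (hCQ : C ⊆ Q) (h1 : C1.Nonempty) (h2 : C2.Nonempty) {a b : ℝ} (ha : 0 ≤ a) (hb : 0 ≤ b)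
    (hab : a + b = 1) (hC : ∀ x ∈ C1, ∀ y ∈ C2, a • x + b • y ∈ C) :
    a * relInradius Q C1 + b * relInradius Q C2 ≤ relInradius Q C := by
  refine le_of_forall_pos_le_add fun ε hε => ?_
  obtain ⟨u, ⟨hu0, t, ht⟩, hu⟩ := exists_feas' (Q := Q) h1 hε
  obtain ⟨v, ⟨hv0, s, hs⟩, hv⟩ := exists_feas' (Q := Q) h2 hε
  have hf : Feas Q C (a * u + b * v) := by
    refine ⟨by positivity, a • t + b • s, fun x hx => ?_⟩
    have := hC _ (ht x hx) _ (hs x hx)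
    convert this using 1
    module
  have := Feas.le_r hQc hQi hCQ hf
  have e : a * ε + b * ε = ε := by rw [← add_mul, hab, one_mul]
  nlinarith

/-- Removing a piece with empty interior. -/
lemma drop {Q : Set E} (hQ : Convex ℝ Q) (hQc : IsCompact Q) (hQi : (interior Q).Nonempty)
    {k : ℕ} {C : Fin (k + 1) → Set E} (hC : IsPart Q C) (i : Fin (k + 1))
    (hi : ¬ (interior (C i)).Nonempty) : IsPart Q (fun j => C (i.succAbove j)) := by
  refine ⟨fun j => hC.closed _, fun j => hC.convex _, ?_, fun j l hjl =>
    hC.disj _ _ (fun h => hjl (Fin.succAbove_right_injective h))⟩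
  apply subset_antisymm
  · exact iUnion_subset fun j => hC.sub _
  have hcl : IsClosed (⋃ j, C (i.succAbove j)) := isClosed_iUnion_of_finite fun j => hC.closed _
  intro x hx
  have h1 := sub_closure_int hQ hQi hx
  by_contra hc
  obtain ⟨y, hy1, hy2⟩ := mem_closure_iff.1 h1 _ hcl.isOpen_compl hc
  apply hi
  refine ⟨y, mem_interior.2 ⟨interior Q ∩ (⋃ j, C (i.succAbove j))ᶜ, ?_,
    isOpen_interior.inter hcl.isOpen_compl, hy2, hy1⟩⟩
  rintro z ⟨hz1, hz2⟩
  obtain ⟨l, hl⟩ := hC.ex (interior_subset hz1)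
  by_cases hli : l = i
  · rwa [hli] at hl
  · obtain ⟨j, rfl⟩ := Fin.exists_succAbove_eq hli
    exact absurd (mem_iUnion.2 ⟨j, hl⟩) hz2

lemma drop_sum {Q : Set E} (hQ : Convex ℝ Q) (hQc : IsCompact Q) (hQi : (interior Q).Nonempty)
    {k : ℕ} (IH : ∀ C : Fin k → Set E, IsPart Q C → 1 ≤ ∑ i, relInradius Q (C i))
    {C : Fin (k + 1) → Set E} (hC : IsPart Q C) (i : Fin (k + 1))
    (hi : ¬ (interior (C i)).Nonempty) : 1 ≤ ∑ i, relInradius Q (C i) := by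
  have := IH _ (drop hQ hQc hQi hC i hi)
  rw [Fin.sum_univ_succAbove _ i]
  linarith [r_nonneg Q (C i)]

/-! ### Minimisation -/

/-- The parameter space. -/
abbrev Par (k : ℕ) := (Fin k → Fin k → E) × (Fin k → Fin k → ℝ)

/-- The pieces determined by a parameter. -/
def D (Q : Set E) {k : ℕ} (w : Par k) (i : Fin k) : Set E :=
  {x | x ∈ Q ∧ ∀ j, j ≠ i → ⟪w.1 i j, x⟫ ≤ w.2 i j}

/-- The admissible parameters. -/
def KK (Q : Set E) (k : ℕ) (R : ℝ) : Set (Par k) :=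
  {w | (∀ i j, i ≠ j → ‖w.1 i j‖ = 1) ∧ (∀ i j, w.1 j i = -w.1 i j) ∧
    (∀ i j, w.2 j i = -w.2 i j) ∧ (∀ i j, |w.2 i j| ≤ R) ∧
    ∀ x ∈ Q, ∃ i, ∀ j, j ≠ i → ⟪w.1 i j, x⟫ ≤ w.2 i j}

lemma D_sub {Q : Set E} {k : ℕ} (w : Par k) (i : Fin k) : D Q w i ⊆ Q := fun _ h => h.1

lemma KK_compact (Q : Set E) (k : ℕ) (R : ℝ) : IsCompact (KK Q k R) := by
  apply Metric.isCompact_of_isClosed_isBounded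
  · have e : KK Q k R = (⋂ i, ⋂ j, {w : Par k | i ≠ j → ‖w.1 i j‖ = 1}) ∩
        ((⋂ i, ⋂ j, {w : Par k | w.1 j i = -w.1 i j}) ∩
        ((⋂ i, ⋂ j, {w : Par k | w.2 j i = -w.2 i j}) ∩
        ((⋂ i, ⋂ j, {w : Par k | |w.2 i j| ≤ R}) ∩
        (⋂ x ∈ Q, ⋃ i, ⋂ j, {w : Par k | j ≠ i → ⟪w.1 i j, x⟫ ≤ w.2 i j})))) := by
      ext w; simp [KK]
    rw [e]
    refine IsClosed.inter ?_ (IsClosed.inter ?_ (IsClosed.inter ?_ (IsClosed.inter ?_ ?_)))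
    · refine isClosed_iInter fun i => isClosed_iInter fun j => ?_
      by_cases h : i = j
      · simp [h]
      · simp only [ne_eq, h, not_false_eq_true, forall_const]
        exact isClosed_eq (by fun_prop) (by fun_prop)
    · refine isClosed_iInter fun i => isClosed_iInter fun j => ?_
      exact isClosed_eq (by fun_prop) (by fun_prop)
    · refine isClosed_iInter fun i => isClosed_iInter fun j => ?_
      exact isClosed_eq (by fun_prop) (by fun_prop)
    · refine isClosed_iInter fun i => isClosed_iInter fun j => ?_
      exact isClosed_le (by fun_prop) (by fun_prop)
    · refine isClosed_biInter fun x _ => isClosed_iUnion_of_finite fun i => isClosed_iInter fun j => ?_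
      by_cases h : j = i
      · simp [h]
      · simp only [ne_eq, h, not_false_eq_true, forall_const]
        exact isClosed_le (by fun_prop) (by fun_prop)
  · refine (Metric.isBounded_closedBall (x := (0 : Par k)) (r := max 1 |R|)).subset fun w hw => ?_
    rw [mem_closedBall_zero_iff, Prod.norm_def]
    have hM : (0 : ℝ) ≤ max 1 |R| := by positivity
    refine max_le ?_ ?_
    · refine (pi_norm_le_iff_of_nonneg hM).2 fun i => (pi_norm_le_iff_of_nonneg hM).2 fun j => ?_
      by_cases h : i = j
      · subst h
        have := hw.2.1 i i
        rw [eq_neg_iff_add_eq_zero, ← two_smul ℝ] at this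
        have h0 : w.1 i i = 0 := (smul_eq_zero.1 this).resolve_left two_ne_zero
        rw [h0, norm_zero]; exact hM
      · rw [hw.1 i j h]; exact le_max_left _ _
    · refine (pi_norm_le_iff_of_nonneg hM).2 fun i => (pi_norm_le_iff_of_nonneg hM).2 fun j => ?_
      rw [Real.norm_eq_abs]
      exact ((hw.2.2.2.1 i j).trans (le_abs_self R)).trans (le_max_right _ _)

lemma D_part {Q : Set E} (hQ : Convex ℝ Q) (hQc : IsCompact Q) {k : ℕ} {R : ℝ} {w : Par k}
    (hw : w ∈ KK Q k R) : IsPart Q (D Q w) := by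
  obtain ⟨h1, h2, h3, h4, h5⟩ := hw
  have e : ∀ i, D Q w i = Q ∩ ⋂ j, {x : E | j ≠ i → ⟪w.1 i j, x⟫ ≤ w.2 i j} := by
    intro i; ext x; simp [D]
  refine ⟨fun i => ?_, fun i => ?_, ?_, fun i j hij => ?_⟩
  · rw [e]
    refine hQc.isClosed.inter (isClosed_iInter fun j => ?_)
    by_cases h : j = i
    · simp [h]
    · simp only [ne_eq, h, not_false_eq_true, forall_const]
      exact isClosed_le (by fun_prop) (by fun_prop)
  · rintro x ⟨hx, hx'⟩ y ⟨hy, hy'⟩ a b ha hb hab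
    refine ⟨hQ hx hy ha hb hab, fun j hj => ?_⟩
    rw [inner_add_right, inner_smul_right, inner_smul_right]
    have := mul_le_mul_of_nonneg_left (hx' j hj) ha
    have := mul_le_mul_of_nonneg_left (hy' j hj) hb
    have : a * w.2 i j + b * w.2 i j = w.2 i j := by rw [← add_mul, hab, one_mul]
    linarith
  · apply subset_antisymm (iUnion_subset fun i => D_sub w i)
    intro x hx
    obtain ⟨i, hi⟩ := h5 x hx
    exact mem_iUnion.2 ⟨i, hx, hi⟩
  · refine SepBy.disj (n := w.1 i j) (c := w.2 i j) ⟨?_, fun y hy => hy.2 j hij.symm, fun y hy => ?_⟩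
    · rw [← norm_ne_zero_iff, h1 i j hij]; exact one_ne_zero
    · have := hy.2 i hij
      rw [h2 i j, h3 i j, inner_neg_left] at this
      linarith

/-- Every partition into bodies comes from a parameter. -/
lemma exists_par {Q : Set E} (hQ : Convex ℝ Q) {k : ℕ} {C : Fin k → Set E}
    (hC : IsPart Q C) (hi : ∀ i, (interior (C i)).Nonempty) {R : ℝ} (hR : ∀ x ∈ Q, ‖x‖ ≤ R) :
    ∃ w ∈ KK Q k R, ∀ i, D Q w i = C i := by
  obtain ⟨n, c, hn, hc, hP⟩ := antisymm_choice
    (fun i j n c => SepBy (C i) (C j) n c ∧ ‖n‖ = 1)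
    (fun i j n c _ h => ⟨h.1.symm, by rw [norm_neg]; exact h.2⟩) (fun i j hij => by
      obtain ⟨n, c, h⟩ := sep_exists (hC.convex i) (hC.convex j) (hi i) (hi j) (hC.disj i j hij)
      have hn : 0 < ‖n‖ := norm_pos_iff.2 h.1
      refine ⟨‖n‖⁻¹ • n, ‖n‖⁻¹ * c, ⟨smul_ne_zero (inv_ne_zero hn.ne') h.1, fun y hy => ?_,
        fun y hy => ?_⟩, ?_⟩
      · rw [real_inner_smul_left]
        exact mul_le_mul_of_nonneg_left (h.2.1 y hy) (by positivity)
      · rw [real_inner_smul_left]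
        exact mul_le_mul_of_nonneg_left (h.2.2 y hy) (by positivity)
      · rw [norm_smul, norm_inv, norm_norm, inv_mul_cancel₀ hn.ne'])
  have hin : ∀ i j, i ≠ j → ∀ x ∈ Q, |⟪n i j, x⟫| ≤ R := fun i j hij x hx => by
    have := abs_real_inner_le_norm (n i j) x
    rw [(hP i j hij).2, one_mul] at this
    exact this.trans (hR x hx)
  refine ⟨(n, c), ⟨fun i j hij => (hP i j hij).2, hn, hc, fun i j => ?_, fun x hx => ?_⟩,
    fun i => ?_⟩
  · obtain ⟨x, hx⟩ := hi i
    obtain ⟨y, hy⟩ := hi j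
    by_cases h : i = j
    · subst h
      have := hc i i
      have h0 : c i i = 0 := by linarith
      simp only [h0, abs_zero]
      exact (norm_nonneg x).trans (hR x (hC.sub i (interior_subset hx)))
    · have h1 := (hP i j h).1.2.1 x (interior_subset hx)
      have h2 := (hP i j h).1.2.2 y (interior_subset hy)
      have h3 := abs_le.1 (hin i j h x (hC.sub i (interior_subset hx)))
      have h4 := abs_le.1 (hin i j h y (hC.sub j (interior_subset hy)))
      exact abs_le.2 ⟨by linarith, by linarith⟩
  · obtain ⟨i, hxi⟩ := hC.ex hx
    exact ⟨i, fun j hj => (hP i j hj.symm).1.2.1 x hxi⟩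
  · apply subset_antisymm
    · rintro x ⟨hx, hx'⟩
      exact refine_sep hQ hC hi (fun i j hij => (hP i j hij).1) i hx hx'
    · exact fun x hx => ⟨hC.sub i hx, fun j hj => (hP i j hj.symm).1.2.1 x hx⟩

lemma r_lsc {Q : Set E} (hQ : Convex ℝ Q) (hQc : IsCompact Q) (hQi : (interior Q).Nonempty)
    {k : ℕ} {R : ℝ} (i : Fin k) :
    LowerSemicontinuousOn (fun w : Par k => relInradius Q (D Q w i)) (KK Q k R) := by
  intro w hw y hy
  by_cases hy0 : y < 0
  · exact Eventually.of_forall fun w' => hy0.trans_le (r_nonneg _ _)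
  push Not at hy0
  obtain ⟨h, ⟨h0, t, ht⟩, hyh⟩ := exists_feas hy0 hy
  obtain ⟨p, hp⟩ := hQi
  have hQi : (interior Q).Nonempty := ⟨p, hp⟩
  obtain ⟨ρ', hρ', hb⟩ := Metric.isOpen_iff.1 isOpen_interior p hp
  set ρ := ρ' / 2 with hρdef
  have hρ : 0 < ρ := by positivity
  obtain ⟨M, hM⟩ := hQc.isBounded.exists_norm_le
  set g := (y + h) / 2 with hg
  have hgy : y < g := by linarith
  have hgh : g < h := by linarith
  have hhp : 0 < h := by linarith
  set δ := (h - g) * ρ with hδ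
  have hδp : 0 < δ := mul_pos (by linarith) hρ
  have hco : ∀ b ∈ Q, ∀ q ∈ Q, h • ((g / h) • b + (1 - g / h) • q) + t ∈ D Q w i := by
    intro b hb q hq
    apply ht
    exact hQ hb hq (div_nonneg (by linarith) h0)
      (by rw [sub_nonneg, div_le_one hhp]; linarith) (by ring)
  have hco' : ∀ b ∈ Q, ∀ q ∈ Q, g • b + (h - g) • q + t ∈ D Q w i := by
    intro b hb q hq
    have := hco b hb q hq
    rw [smul_add, smul_smul, smul_smul, mul_div_cancel₀ _ hhp.ne',
      show h * (1 - g / h) = h - g by field_simp] at this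
    exact this
  have hev : ∀ᶠ w' : Par k in 𝓝 w, ∀ j,
      ‖w'.1 i j - w.1 i j‖ * M + |w'.2 i j - w.2 i j| < δ := by
    rw [eventually_all]
    intro j
    have hcont : Continuous fun w' : Par k =>
        ‖w'.1 i j - w.1 i j‖ * M + |w'.2 i j - w.2 i j| := by fun_prop
    refine hcont.continuousAt.eventually_lt continuousAt_const ?_
    simpa using hδp
  refine (hev.filter_mono nhdsWithin_le_nhds).mono fun w' hw' => ?_
  refine hgy.trans_le (Feas.le_r hQc hQi (D_sub _ _) ⟨by linarith, (h - g) • p + t, ?_⟩)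
  intro b hb'
  have hz := hco' b hb' p (interior_subset hp)
  rw [← add_assoc]
  refine ⟨hz.1, fun j hj => ?_⟩
  have hn := hw.1 i j hj.symm
  have hq : p + ρ • w.1 i j ∈ Q := interior_subset (hb (by
    rw [Metric.mem_ball, dist_eq_norm, add_sub_cancel_left, norm_smul, hn, Real.norm_eq_abs,
      abs_of_pos hρ]; linarith))
  have h2 := (hco' b hb' _ hq).2 j hj
  have e : g • b + (h - g) • (p + ρ • w.1 i j) + t
      = (g • b + (h - g) • p + t) + δ • w.1 i j := by rw [hδ]; module
  rw [e, inner_add_right, inner_smul_right, real_inner_self_eq_norm_sq, hn] at h2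
  have h3 := hw' j
  set z := g • b + (h - g) • p + t
  have h4 : ⟪w'.1 i j, z⟫ = ⟪w.1 i j, z⟫ + ⟪w'.1 i j - w.1 i j, z⟫ := by
    rw [inner_sub_left]; ring
  have h5 := real_inner_le_norm (w'.1 i j - w.1 i j) z
  have h6 := mul_le_mul_of_nonneg_left (hM z hz.1) (norm_nonneg (w'.1 i j - w.1 i j))
  have h7 := neg_abs_le (w'.2 i j - w.2 i j)
  rw [h4]
  linarith

/-- A lexicographic minimiser. -/
lemma exists_min {Q : Set E} (hQ : Convex ℝ Q) (hQc : IsCompact Q) (hQi : (interior Q).Nonempty)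
    {k : ℕ} (i0 : Fin k)
    (hE : ∀ C : Fin k → Set E, IsPart Q C → (∑ i, relInradius Q (C i)) < 1 →
      ∀ i, (interior (C i)).Nonempty)
    {C0 : Fin k → Set E} (hC0 : IsPart Q C0) (hF0 : (∑ i, relInradius Q (C0 i)) < 1) :
    ∃ A : Fin k → Set E, IsPart Q A ∧ (∑ i, relInradius Q (A i)) < 1 ∧
      (∀ C : Fin k → Set E, IsPart Q C →
        (∑ i, relInradius Q (A i)) ≤ ∑ i, relInradius Q (C i)) ∧
      (∀ C : Fin k → Set E, IsPart Q C →
        (∑ i, relInradius Q (C i)) ≤ (∑ i, relInradius Q (A i)) →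
        relInradius Q (A i0) ≤ relInradius Q (C i0)) := by
  obtain ⟨R, hR⟩ := hQc.isBounded.exists_norm_le
  have hK := KK_compact Q k R
  set F : Par k → ℝ := fun w => ∑ i, relInradius Q (D Q w i) with hFdef
  have hFl : LowerSemicontinuousOn F (KK Q k R) :=
    lowerSemicontinuousOn_sum fun i _ => r_lsc hQ hQc hQi i
  have hpar : ∀ C : Fin k → Set E, IsPart Q C → (∑ i, relInradius Q (C i)) < 1 →
      ∃ w ∈ KK Q k R, D Q w = C := fun C hC h => by
    obtain ⟨w, hw, he⟩ := exists_par hQ hC (hE C hC h) hR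
    exact ⟨w, hw, funext he⟩
  obtain ⟨w0, hw0, he0⟩ := hpar C0 hC0 hF0
  obtain ⟨w1, hw1, hm1⟩ := hFl.exists_isMinOn ⟨w0, hw0⟩ hK
  have hF1 : F w1 < 1 := by
    refine (hm1 hw0).trans_lt ?_
    simp only [hFdef, he0]; exact hF0
  have hK2 : IsCompact {w | w ∈ KK Q k R ∧ F w ≤ F w1} := by
    refine hK.of_isClosed_subset ?_ fun w h => h.1
    obtain ⟨u, hu, hu'⟩ := lowerSemicontinuousOn_iff_preimage_Iic.1 hFl (F w1)
    have e : {w | w ∈ KK Q k R ∧ F w ≤ F w1} = KK Q k R ∩ u := by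
      rw [← hu']; rfl
    rw [e]
    exact hK.isClosed.inter hu
  have hl2 : LowerSemicontinuousOn (fun w : Par k => relInradius Q (D Q w i0))
      {w | w ∈ KK Q k R ∧ F w ≤ F w1} := (r_lsc hQ hQc hQi i0).mono fun w h => h.1
  have hne2 : {w | w ∈ KK Q k R ∧ F w ≤ F w1}.Nonempty := ⟨w1, hw1, le_rfl⟩
  obtain ⟨w2, hw2, hm2⟩ := LowerSemicontinuousOn.exists_isMinOn hne2 hK2 hl2
  have hmin : ∀ C : Fin k → Set E, IsPart Q C → F w1 ≤ ∑ i, relInradius Q (C i) := by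
    intro C hC
    by_cases h : (∑ i, relInradius Q (C i)) < 1
    · obtain ⟨w, hw, rfl⟩ := hpar C hC h
      exact hm1 hw
    · push Not at h; linarith
  refine ⟨D Q w2, D_part hQ hQc hw2.1, hw2.2.trans_lt hF1, fun C hC => hw2.2.trans (hmin C hC),
    fun C hC h => ?_⟩
  have h' := h.trans hw2.2
  obtain ⟨w, hw, rfl⟩ := hpar C hC (h'.trans_lt hF1)
  exact hm2 (show w ∈ {w | w ∈ KK Q k R ∧ F w ≤ F w1} from ⟨hw, h'⟩)

/-! ### Dilating the minimiser -/

/-- The dilated pieces. -/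
def Cl (Q : Set E) {k : ℕ} (n : Fin k → Fin k → E) (c : Fin k → Fin k → ℝ) (p : E) (l : ℝ)
    (i : Fin k) : Set E :=
  {x | x ∈ Q ∧ ∀ j, j ≠ i → ⟪n i j, p + l • (x - p)⟫ ≤ c i j}

lemma Cl_comb {Q : Set E} (hQ : Convex ℝ Q) {k : ℕ} {n : Fin k → Fin k → E}
    {c : Fin k → Fin k → ℝ} {p : E} {l m θ φ : ℝ} (hθ : 0 ≤ θ) (hφ : 0 ≤ φ) (hl : 0 ≤ l)
    (hm : 0 ≤ m) (h1 : θ + φ = 1) (h2 : θ * l + φ * m = 1) (i : Fin k) :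
    ∀ x ∈ Cl Q n c p l i, ∀ y ∈ Cl Q n c p m i,
      (θ * l) • x + (φ * m) • y ∈ Cl Q n c p 1 i := by
  rintro x ⟨hx, hx'⟩ y ⟨hy, hy'⟩
  refine ⟨hQ hx hy (by positivity) (by positivity) h2, fun j hj => ?_⟩
  have e : p + (1 : ℝ) • ((θ * l) • x + (φ * m) • y - p)
      = θ • (p + l • (x - p)) + φ • (p + m • (y - p)) := by
    have e1 : φ * m = 1 - θ * l := by linarith
    have e2 : φ = 1 - θ := by linarith
    have e3 : φ • (p + m • (y - p)) = φ • p + (φ * m) • (y - p) := by module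
    rw [e3, e1, e2]; module
  rw [e, inner_add_right, inner_smul_right, inner_smul_right]
  have := mul_le_mul_of_nonneg_left (hx' j hj) hθ
  have := mul_le_mul_of_nonneg_left (hy' j hj) hφ
  have : θ * c i j + φ * c i j = c i j := by rw [← add_mul, h1, one_mul]
  linarith

lemma Cl_part {Q : Set E} (hQ : Convex ℝ Q) (hQc : IsCompact Q) {k : ℕ} {n : Fin k → Fin k → E}
    {c : Fin k → Fin k → ℝ} {p : E} {l : ℝ} (hl : 0 < l) (hn0 : ∀ i j, i ≠ j → n i j ≠ 0)
    (hn : ∀ i j, n j i = -n i j) (hc : ∀ i j, c j i = -c i j)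
    (hcov : ∀ x ∈ Q, ∃ i, ∀ j, j ≠ i → ⟪n i j, p + l • (x - p)⟫ ≤ c i j) :
    IsPart Q (Cl Q n c p l) := by
  have key : ∀ i j x, ⟪n i j, p + l • (x - p)⟫ ≤ c i j ↔
      ⟪n i j, x⟫ ≤ (c i j - ⟪n i j, p⟫) / l + ⟪n i j, p⟫ := by
    intro i j x
    rw [inner_add_right, inner_smul_right, inner_sub_right, ← sub_le_iff_le_add, le_div_iff₀ hl]
    constructor <;> intro h <;> linarith
  have e : ∀ i, Cl Q n c p l i
      = Q ∩ ⋂ j, {x : E | j ≠ i → ⟪n i j, p + l • (x - p)⟫ ≤ c i j} := by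
    intro i; ext x; simp [Cl]
  refine ⟨fun i => ?_, fun i => ?_, ?_, fun i j hij => ?_⟩
  · rw [e]
    refine hQc.isClosed.inter (isClosed_iInter fun j => ?_)
    by_cases h : j = i
    · simp [h]
    · simp only [ne_eq, h, not_false_eq_true, forall_const]
      exact isClosed_le (by fun_prop) (by fun_prop)
  · rintro x ⟨hx, hx'⟩ y ⟨hy, hy'⟩ a b ha hb hab
    refine ⟨hQ hx hy ha hb hab, fun j hj => ?_⟩
    rw [key, inner_add_right, inner_smul_right, inner_smul_right]
    have h1 := mul_le_mul_of_nonneg_left ((key _ _ _).1 (hx' j hj)) ha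
    have h2 := mul_le_mul_of_nonneg_left ((key _ _ _).1 (hy' j hj)) hb
    set q := (c i j - ⟪n i j, p⟫) / l + ⟪n i j, p⟫
    have : a * q + b * q = q := by rw [← add_mul, hab, one_mul]
    linarith
  · apply subset_antisymm (iUnion_subset fun i x hx => hx.1)
    intro x hx
    obtain ⟨i, hi⟩ := hcov x hx
    exact mem_iUnion.2 ⟨i, hx, hi⟩
  · refine SepBy.disj (n := n i j) (c := (c i j - ⟪n i j, p⟫) / l + ⟪n i j, p⟫)
      ⟨hn0 i j hij, fun y hy => (key _ _ _).1 (hy.2 j hij.symm), fun y hy => ?_⟩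
    have := (key _ _ _).1 (hy.2 i hij)
    rw [hn i j, hc i j, inner_neg_left, inner_neg_left,
      show -c i j - -⟪n i j, p⟫ = -(c i j - ⟪n i j, p⟫) by ring, neg_div] at this
    linarith

lemma no_min {Q : Set E} (hQ : Convex ℝ Q) (hQc : IsCompact Q) (hQi : (interior Q).Nonempty)
    {k : ℕ} (i0 : Fin k) {A : Fin k → Set E} (hA : IsPart Q A)
    (hi : ∀ i, (interior (A i)).Nonempty) (hF : (∑ i, relInradius Q (A i)) < 1)
    (hm : ∀ C : Fin k → Set E, IsPart Q C →
        (∑ i, relInradius Q (A i)) ≤ ∑ i, relInradius Q (C i))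
    (hm' : ∀ C : Fin k → Set E, IsPart Q C →
        (∑ i, relInradius Q (C i)) ≤ (∑ i, relInradius Q (A i)) →
        relInradius Q (A i0) ≤ relInradius Q (C i0)) : False := by
  obtain ⟨n, c, hs, hn, hc, hx⟩ := extension hQ hQc hQi hA hi
  obtain ⟨p, hp⟩ := hi i0
  choose b hb using hi
  have hcont : Continuous fun z : ℝ × E => p + z.1 • (z.2 - p) := by fun_prop
  have hA1 : ∀ i, Cl Q n c p 1 i = A i := by
    intro i
    ext x
    simp only [Cl, mem_ofPred_eq, one_smul, add_sub_cancel]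
    constructor
    · rintro ⟨h1, h2⟩
      exact refine_sep hQ hA (fun i => ⟨b i, hb i⟩) hs i h1 h2
    · exact fun h => ⟨hA.sub i h, fun j hj => (hs i j hj.symm).2.1 x h⟩
  have hcov : ∀ᶠ l : ℝ in 𝓝 1, ∀ x ∈ Q, ∃ i, ∀ j, j ≠ i → ⟪n i j, p + l • (x - p)⟫ ≤ c i j := by
    refine hQc.eventually_forall_of_forall_eventually fun x hxQ => ?_
    have h1 : Tendsto (fun z : ℝ × E => p + z.1 • (z.2 - p)) (𝓝 ((1 : ℝ), x)) (𝓝 x) := by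
      have := hcont.tendsto ((1 : ℝ), x)
      simpa using this
    exact h1.eventually (hx x hxQ)
  have hne : ∀ᶠ l : ℝ in 𝓝 1, ∀ i, p + l • (b i - p) ∈ interior (A i) := by
    rw [eventually_all]
    intro i
    have h1 : Tendsto (fun z : ℝ => p + z • (b i - p)) (𝓝 (1 : ℝ)) (𝓝 (b i)) := by
      have : Continuous fun z : ℝ => p + z • (b i - p) := by fun_prop
      simpa using this.tendsto 1
    exact h1.eventually (isOpen_interior.mem_nhds (hb i))
  have hsm : ∀ᶠ l : ℝ in 𝓝 0, ∀ x ∈ Q, p + l • (x - p) ∈ interior (A i0) := by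
    refine hQc.eventually_forall_of_forall_eventually fun x hxQ => ?_
    have h1 : Tendsto (fun z : ℝ × E => p + z.1 • (z.2 - p)) (𝓝 ((0 : ℝ), x)) (𝓝 p) := by
      have := hcont.tendsto ((0 : ℝ), x)
      simpa using this
    exact h1.eventually (isOpen_interior.mem_nhds hp)
  obtain ⟨ε, hε, hball⟩ := Metric.eventually_nhds_iff.1 (hcov.and hne)
  obtain ⟨ε2, hε2, hball2⟩ := Metric.eventually_nhds_iff.1 hsm
  set e := min (ε / 2) (1 / 2) with he
  have he0 : 0 < e := by positivity
  have he1 : e ≤ 1 / 2 := min_le_right _ _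
  have he2 : e < ε := (min_le_left _ _).trans_lt (by linarith)
  set l0 := min (ε2 / 2) (1 / 2) with hl0
  have hl00 : 0 < l0 := by positivity
  have hl01 : l0 ≤ 1 / 2 := min_le_right _ _
  have hl02 : l0 < ε2 := (min_le_left _ _).trans_lt (by linarith)
  obtain ⟨hcp, hnp⟩ := hball (y := 1 + e) (by
    rw [Real.dist_eq, add_sub_cancel_left, abs_of_pos he0]; exact he2)
  obtain ⟨hcm, hnm⟩ := hball (y := 1 - e) (by
    rw [Real.dist_eq, show 1 - e - 1 = -e by ring, abs_neg, abs_of_pos he0]; exact he2)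
  have hz := hball2 (y := l0) (by rw [Real.dist_eq, sub_zero, abs_of_pos hl00]; exact hl02)
  have hn0 : ∀ i j, i ≠ j → n i j ≠ 0 := fun i j hij => (hs i j hij).1
  have hPp : IsPart Q (Cl Q n c p (1 + e)) := Cl_part hQ hQc (by linarith) hn0 hn hc hcp
  have hPm : IsPart Q (Cl Q n c p (1 - e)) := Cl_part hQ hQc (by linarith) hn0 hn hc hcm
  have hNp : ∀ i, (Cl Q n c p (1 + e) i).Nonempty := fun i => ⟨b i, hA.sub i (interior_subset (hb i)),
    fun j hj => (hs i j hj.symm).2.1 _ (interior_subset (hnp i))⟩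
  have hNm : ∀ i, (Cl Q n c p (1 - e) i).Nonempty := fun i => ⟨b i, hA.sub i (interior_subset (hb i)),
    fun j hj => (hs i j hj.symm).2.1 _ (interior_subset (hnm i))⟩
  have hconc : ∀ i, (1 / 2 * (1 + e)) * relInradius Q (Cl Q n c p (1 + e) i) +
      (1 / 2 * (1 - e)) * relInradius Q (Cl Q n c p (1 - e) i) ≤ relInradius Q (A i) := by
    intro i
    refine r_concave hQc hQi (hA.sub i) (hNp i) (hNm i) (by linarith) (by linarith) (by ring) ?_
    rw [← hA1 i]
    exact Cl_comb hQ (by norm_num) (by norm_num) (by linarith) (by linarith) (by norm_num)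
      (by ring) i
  have hsum := Finset.sum_le_sum fun i (_ : i ∈ Finset.univ) => hconc i
  rw [Finset.sum_add_distrib, ← Finset.mul_sum, ← Finset.mul_sum] at hsum
  have hle : (∑ i, relInradius Q (Cl Q n c p (1 + e) i)) ≤ ∑ i, relInradius Q (A i) := by
    have := hm _ hPm
    nlinarith
  have hge := hm' _ hPp hle
  have hQ0 : Cl Q n c p l0 i0 = Q := by
    apply subset_antisymm (fun x h => h.1)
    exact fun x hxQ => ⟨hxQ, fun j hj => (hs i0 j hj.symm).2.1 _ (interior_subset (hz x hxQ))⟩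
  set θ := (1 - l0) / (1 + e - l0) with hθ
  have hden : 0 < 1 + e - l0 := by linarith
  have hθ0 : 0 ≤ θ := div_nonneg (by linarith) hden.le
  have hθ1 : θ < 1 := by rw [hθ, div_lt_one hden]; linarith
  have hθ2 : θ * (1 + e) + (1 - θ) * l0 = 1 := by
    rw [hθ]; field_simp; ring
  have hfin : (θ * (1 + e)) * relInradius Q (Cl Q n c p (1 + e) i0) +
      ((1 - θ) * l0) * relInradius Q (Cl Q n c p l0 i0) ≤ relInradius Q (A i0) := by
    refine r_concave hQc hQi (hA.sub i0) (hNp i0) (by rw [hQ0]; exact hQi.mono interior_subset)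
      (mul_nonneg hθ0 (by linarith)) (mul_nonneg (by linarith) hl00.le) hθ2 ?_
    rw [← hA1 i0]
    exact Cl_comb hQ hθ0 (by linarith) (by linarith) hl00.le (by ring) hθ2 i0
  rw [hQ0] at hfin
  have h1 := one_le_r hQc hQi
  have hβ : 0 < (1 - θ) * l0 := mul_pos (by linarith) hl00
  have hα : 0 ≤ θ * (1 + e) := mul_nonneg hθ0 (by linarith)
  have hsingle : relInradius Q (A i0) ≤ ∑ i, relInradius Q (A i) :=
    Finset.single_le_sum (f := fun i => relInradius Q (A i)) (fun i _ => r_nonneg _ _)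
      (Finset.mem_univ i0)
  have g1 := mul_le_mul_of_nonneg_left hge hα
  have g2 := mul_le_mul_of_nonneg_left h1 hβ.le
  have g3 : θ * (1 + e) = 1 - (1 - θ) * l0 := by linarith
  rw [g3] at g1 hfin
  nlinarith

lemma main {Q : Set E} (hQ : Convex ℝ Q) (hQc : IsCompact Q) (hQi : (interior Q).Nonempty)
    (k : ℕ) : ∀ C : Fin k → Set E, IsPart Q C → 1 ≤ ∑ i, relInradius Q (C i) := by
  induction k with
  | zero =>
    intro C hC
    obtain ⟨x, hx⟩ := hQi
    obtain ⟨i, _⟩ := hC.ex (interior_subset hx)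
    exact i.elim0
  | succ k IH =>
    intro C hC
    by_contra hlt
    push Not at hlt
    have hE : ∀ C : Fin (k + 1) → Set E, IsPart Q C → (∑ i, relInradius Q (C i)) < 1 →
        ∀ i, (interior (C i)).Nonempty := by
      intro C hC h i
      by_contra hi
      exact absurd (drop_sum hQ hQc hQi IH hC i hi) (not_le.2 h)
    obtain ⟨A, hA, hF, hm, hm'⟩ := exists_min hQ hQc hQi 0 hE hC hlt
    exact no_min hQ hQc hQi 0 hA (hE A hA hF) hF hm hm'

end Kadets

theorem kadets_two_dim (k : ℕ) (B : Set (EuclideanSpace ℝ (Fin 2)))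
    (hBconv : Convex ℝ B) (hBcomp : IsCompact B) (hBint : (interior B).Nonempty)
    (C : Fin k → Set (EuclideanSpace ℝ (Fin 2)))
    (hCcl : ∀ i, IsClosed (C i)) (hCconv : ∀ i, Convex ℝ (C i))
    (hCcover : (⋃ i, C i) = B)
    (hCdisj : ∀ i j, i ≠ j → interior (C i) ∩ interior (C j) = ∅) :
    1 ≤ ∑ i, relInradius B (C i) :=
  Kadets.main hBconv hBcomp hBint k C ⟨hCcl, hCconv, hCcover, hCdisj⟩
end

section
/- Any partition C₁ ∪ ⋯ ∪ C_k = B of a convex body B ⊂ ℝ² into closed convex sets with pairwise disjoint interiors can be extended to a partition V₁ ∪ ⋯ ∪ V_k = ℝ² of the whole plane into closed convex sets with pairwise disjoint interiors such that V_i ∩ B = C_i for every i. -/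
open Set Filter Topology


/-- The kernel of a nonzero functional on the plane is spanned by one vector. -/
lemma pe_exists_dir (f : (EuclideanSpace ℝ (Fin 2)) →L[ℝ] ℝ) (hf : f ≠ 0) :
    ∃ e : (EuclideanSpace ℝ (Fin 2)), e ≠ 0 ∧ f e = 0 ∧ ∀ w, f w = 0 → ∃ t : ℝ, w = t • e := by
  have hf' : (f : (EuclideanSpace ℝ (Fin 2)) →ₗ[ℝ] ℝ) ≠ 0 := by
    intro h
    apply hf
    ext x
    exact congrArg (fun g : (EuclideanSpace ℝ (Fin 2)) →ₗ[ℝ] ℝ => g x) h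
  have h1 := Module.Dual.finrank_ker_add_one_of_ne_zero (f := (f : (EuclideanSpace ℝ (Fin 2)) →ₗ[ℝ] ℝ)) hf'
  have h2 : Module.finrank ℝ (LinearMap.ker (f : (EuclideanSpace ℝ (Fin 2)) →ₗ[ℝ] ℝ)) = 1 := by
    have h3 : Module.finrank ℝ (EuclideanSpace ℝ (Fin 2)) = 2 := by simp
    rw [h3] at h1
    omega
  obtain ⟨v, hv0, hv⟩ := finrank_eq_one_iff'.1 h2
  refine ⟨v, by simpa using hv0, v.2, fun w hw => ?_⟩
  obtain ⟨t, ht⟩ := hv ⟨w, hw⟩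
  exact ⟨t, by simpa using (congrArg Subtype.val ht).symm⟩

lemma pe_closure {C : Set (EuclideanSpace ℝ (Fin 2))} (h1 : IsClosed C) (h2 : Convex ℝ C) (h3 : (interior C).Nonempty) :
    closure (interior C) = C := by
  rw [h2.closure_interior_eq_closure_of_nonempty_interior h3, h1.closure_eq]

/-- Interior points of a subset of a half-plane lie strictly inside. -/
lemma pe_lt {f : (EuclideanSpace ℝ (Fin 2)) →L[ℝ] ℝ} (hf : f ≠ 0) {c : ℝ} {C : Set (EuclideanSpace ℝ (Fin 2))} (h : ∀ x ∈ C, f x ≤ c)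
    {o : (EuclideanSpace ℝ (Fin 2))} (ho : o ∈ interior C) : f o < c := by
  obtain ⟨w, hw⟩ : ∃ w, 0 < f w := by
    obtain ⟨w, hw⟩ : ∃ w, f w ≠ 0 := by
      by_contra! h'
      exact hf (by ext x; simpa using h' x)
    rcases lt_or_gt_of_ne hw with h' | h'
    · exact ⟨-w, by simpa using h'⟩
    · exact ⟨w, h'⟩
  have hc : Tendsto (fun t : ℝ => o + t • w) (𝓝[>] 0) (𝓝 o) := by
    have : ContinuousAt (fun t : ℝ => o + t • w) 0 := by fun_prop
    have h' := this.tendsto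
    simp only [zero_smul, add_zero] at h'
    exact h'.mono_left nhdsWithin_le_nhds
  have h1 := hc.eventually (isOpen_interior.mem_nhds ho)
  obtain ⟨t, ht, ht0⟩ := (h1.and self_mem_nhdsWithin).exists
  have := h _ (interior_subset ht)
  simp only [map_add, map_smul, smul_eq_mul] at this
  have h0 : (0:ℝ) < t := ht0
  nlinarith [mul_pos h0 hw]

/-- Separation of two cells. -/
lemma pe_sep {f : (EuclideanSpace ℝ (Fin 2)) →L[ℝ] ℝ} (hf : f ≠ 0) {c : ℝ} {e p : (EuclideanSpace ℝ (Fin 2))} (hp : f p = c)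
    (he : ∀ w, f w = 0 → ∃ t : ℝ, w = t • e) {C C' : Set (EuclideanSpace ℝ (Fin 2))}
    (h1 : IsClosed C) (h2 : Convex ℝ C) (h3 : (interior C).Nonempty) (h4 : ∀ x ∈ C, f x ≤ c)
    (h1' : IsClosed C') (h2' : Convex ℝ C') (h3' : (interior C').Nonempty)
    (h4' : ∀ x ∈ C', f x ≤ c) (hd : interior C ∩ interior C' = ∅) :
    ∃ (g : (EuclideanSpace ℝ (Fin 2)) →L[ℝ] ℝ) (u : ℝ), (∀ x ∈ C, g x ≤ u) ∧ (∀ x ∈ C', u ≤ g x) ∧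
      ((∃ s : ℝ, p + s • e ∈ C) → (∃ s : ℝ, p + s • e ∈ C') → g e ≠ 0) := by
  obtain ⟨g, u, ha, hb⟩ := geometric_hahn_banach_open_open h2.interior isOpen_interior
    h2'.interior isOpen_interior (Set.disjoint_iff_inter_eq_empty.2 hd)
  have ha' : ∀ x ∈ C, g x ≤ u := by
    intro x hx
    rw [← pe_closure h1 h2 h3] at hx
    exact closure_minimal (fun y hy => (ha y hy).le)
      (isClosed_le g.continuous continuous_const) hx
  have hb' : ∀ x ∈ C', u ≤ g x := by
    intro x hx
    rw [← pe_closure h1' h2' h3'] at hx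
    exact closure_minimal (fun y hy => (hb y hy).le)
      (isClosed_le continuous_const g.continuous) hx
  refine ⟨g, u, ha', hb', ?_⟩
  rintro ⟨s, hs⟩ ⟨s', hs'⟩ hge
  have e1 := ha' _ hs
  have e2 := hb' _ hs'
  simp only [map_add, map_smul, hge, smul_eq_mul, mul_zero, add_zero] at e1 e2
  obtain ⟨o, ho⟩ := h3
  obtain ⟨o', ho'⟩ := h3'
  have l1 := pe_lt hf h4 ho
  have l2 := pe_lt hf h4' ho'
  have k1 := ha o ho
  have k2 := hb o' ho'
  obtain ⟨t, ht⟩ := he ((f (o' - p)) • (o - p) - (f (o - p)) • (o' - p)) (by simp; ring)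
  have hg := congrArg g ht
  simp only [map_sub, map_smul, smul_eq_mul, hge, mul_zero] at hg
  rw [hp] at hg
  have q1 : g o < g p := by linarith
  have q2 : g p < g o' := by linarith
  nlinarith [mul_pos (sub_pos.2 l2) (sub_pos.2 q1), mul_pos (sub_pos.2 l1) (sub_pos.2 q2)]

/-- Pigeonhole: an interval covered by finitely many sets. -/
lemma pe_pigeon {ι : Type*} [Finite ι] (S : ι → Set ℝ) {u v : ℝ} (huv : u < v)
    (h : ∀ s ∈ Ioo u v, ∃ i, s ∈ S i) :
    ∃ i s t, s ∈ S i ∧ t ∈ S i ∧ u < s ∧ s < t ∧ t < v := by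
  by_contra! hcon
  have hfin : ∀ i, (S i ∩ Ioo u v).Subsingleton := by
    rintro i a ⟨ha, ha'⟩ b ⟨hb, hb'⟩
    by_contra hne
    rcases lt_or_gt_of_ne hne with h' | h'
    · exact absurd hb'.2 (not_lt.2 (hcon i a b ha hb ha'.1 h'))
    · exact absurd ha'.2 (not_lt.2 (hcon i b a hb ha hb'.1 h'))
  have : (⋃ i, S i ∩ Ioo u v).Finite := Set.finite_iUnion fun i => (hfin i).finite
  refine (Set.Ioo_infinite huv) (this.subset ?_)
  intro s hs
  obtain ⟨i, hi⟩ := h s hs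
  exact mem_iUnion.2 ⟨i, hi, hs⟩

/-- Union of two convex sets on the two sides of a line. -/
lemma pe_convex_union {f : (EuclideanSpace ℝ (Fin 2)) →L[ℝ] ℝ} {c : ℝ} {C A : Set (EuclideanSpace ℝ (Fin 2))} (hC : Convex ℝ C) (hA : Convex ℝ A)
    (hCf : ∀ x ∈ C, f x ≤ c) (hAf : ∀ x ∈ A, c ≤ f x)
    (h : ∀ u ∈ C, ∀ w ∈ A, ∀ z ∈ segment ℝ u w, f z = c → z ∈ C ∧ z ∈ A) :
    Convex ℝ (C ∪ A) := by
  have key : ∀ u ∈ C, ∀ w ∈ A, segment ℝ u w ⊆ C ∪ A := by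
    intro u hu w hw
    obtain ⟨t, ht, hft⟩ : ∃ t ∈ Icc (0:ℝ) 1, f (AffineMap.lineMap u w t) = c := by
      have hcont : ContinuousOn (fun t : ℝ => f (AffineMap.lineMap u w t)) (Icc 0 1) := by
        apply Continuous.continuousOn
        exact f.continuous.comp AffineMap.lineMap_continuous
      have := intermediate_value_Icc (zero_le_one) hcont
      obtain ⟨t, ht, h'⟩ := this (show c ∈ _ by simpa using ⟨hCf u hu, hAf w hw⟩)
      exact ⟨t, ht, h'⟩
    obtain ⟨zC, zA⟩ := h u hu w hw (AffineMap.lineMap u w t)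
      (by rw [segment_eq_image_lineMap]; exact ⟨t, ht, rfl⟩) hft
    intro x hx
    rw [segment_eq_image_lineMap] at hx
    obtain ⟨r, hr, rfl⟩ := hx
    rcases le_total r t with hrt | hrt
    · left
      rcases eq_or_lt_of_le ht.1 with h0 | h0
      · have : r = 0 := le_antisymm (by linarith) hr.1
        simpa [this] using hu
      · refine hC.segment_subset hu zC ?_
        rw [segment_eq_image_lineMap]
        refine ⟨r / t, ⟨by have := hr.1; positivity, by rw [div_le_one h0]; exact hrt⟩, ?_⟩
        simp only [AffineMap.lineMap_apply_module']
        rw [add_sub_cancel_right, smul_smul, div_mul_cancel₀ _ h0.ne']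
    · right
      rcases eq_or_lt_of_le ht.2 with h0 | h0
      · have : r = 1 := le_antisymm hr.2 (by linarith)
        simpa [this] using hw
      · refine hA.segment_subset zA hw ?_
        rw [segment_eq_image_lineMap]
        have h1 : 0 < 1 - t := by linarith
        refine ⟨(r - t) / (1 - t), ⟨div_nonneg (by linarith) h1.le,
          by rw [div_le_one h1]; linarith [hr.2]⟩, ?_⟩
        simp only [AffineMap.lineMap_apply_module']
        have : (w - (t • (w - u) + u)) = (1 - t) • (w - u) := by module
        rw [this, smul_smul, div_mul_cancel₀ _ h1.ne']
        module
  rw [convex_iff_segment_subset]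
  rintro x (hx | hx) y (hy | hy)
  · exact (hC.segment_subset hx hy).trans subset_union_left
  · exact key x hx y hy
  · rw [segment_symm]; exact key y hy x hx
  · exact (hA.segment_subset hx hy).trans subset_union_right

/-- Extending a partition across one half-plane boundary. -/
lemma pe_step {ι : Type*} [Finite ι] [Nonempty ι] {D : Set (EuclideanSpace ℝ (Fin 2))} (hDcl : IsClosed D)
    (hD : Convex ℝ D) (f : (EuclideanSpace ℝ (Fin 2)) →L[ℝ] ℝ) (c : ℝ) (C : ι → Set (EuclideanSpace ℝ (Fin 2)))
    (hcl : ∀ i, IsClosed (C i)) (hcv : ∀ i, Convex ℝ (C i)) (hne : ∀ i, (interior (C i)).Nonempty)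
    (hcov : (⋃ i, C i) = D ∩ {x | f x ≤ c})
    (hdisj : ∀ i j, i ≠ j → interior (C i) ∩ interior (C j) = ∅) :
    ∃ V : ι → Set (EuclideanSpace ℝ (Fin 2)), (∀ i, IsClosed (V i)) ∧ (∀ i, Convex ℝ (V i)) ∧ (⋃ i, V i) = D ∧
      (∀ i j, i ≠ j → interior (V i) ∩ interior (V j) = ∅) ∧ ∀ i, C i ⊆ V i := by
  by_cases habove : ∀ w ∈ D, f w ≤ c
  · refine ⟨C, hcl, hcv, ?_, hdisj, fun i => subset_rfl⟩
    rw [hcov]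
    exact inter_eq_left.2 habove
  push Not at habove
  obtain ⟨w, hwD, hwc⟩ := habove
  have hCD : ∀ i, C i ⊆ D := fun i x hx => (hcov ▸ mem_iUnion.2 ⟨i, hx⟩ : x ∈ D ∩ _).1
  have hCf : ∀ i, ∀ x ∈ C i, f x ≤ c := fun i x hx =>
    (hcov ▸ mem_iUnion.2 ⟨i, hx⟩ : x ∈ D ∩ {x | f x ≤ c}).2
  obtain ⟨i0⟩ := ‹Nonempty ι›
  obtain ⟨o, ho⟩ := hne i0
  have hf : f ≠ 0 := by
    rintro rfl
    have := hCf i0 o (interior_subset ho)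
    simp at this hwc
    linarith
  obtain ⟨e, he0, hfe, he⟩ := pe_exists_dir f hf
  have hoc : f o < c := pe_lt hf (hCf i0) ho
  -- a second interior point
  obtain ⟨ε, hε, hoε⟩ : ∃ ε : ℝ, 0 < ε ∧ o + ε • e ∈ C i0 := by
    have hc : Tendsto (fun t : ℝ => o + t • e) (𝓝[>] 0) (𝓝 o) := by
      have : ContinuousAt (fun t : ℝ => o + t • e) 0 := by fun_prop
      have h' := this.tendsto
      simp only [zero_smul, add_zero] at h'
      exact h'.mono_left nhdsWithin_le_nhds
    obtain ⟨t, ht, ht0⟩ := ((hc.eventually (isOpen_interior.mem_nhds ho)).and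
      self_mem_nhdsWithin).exists
    exact ⟨t, ht0, interior_subset ht⟩
  -- the base point on the line
  obtain ⟨p, δ, hpc, hδ, hpD, hpδ⟩ : ∃ (p : (EuclideanSpace ℝ (Fin 2))) (δ : ℝ), f p = c ∧ 0 < δ ∧ p ∈ D ∧
      p + δ • e ∈ D := by
    have hpos : 0 < f w - f o := by linarith
    set τ := (c - f o) / (f w - f o) with hτ
    have t0 : 0 < τ := div_pos (by linarith) hpos
    have t1 : τ < 1 := by rw [hτ, div_lt_one hpos]; linarith
    have tm : τ * (f w - f o) = c - f o := div_mul_cancel₀ _ hpos.ne'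
    refine ⟨(1 - τ) • o + τ • w, (1 - τ) * ε, ?_, mul_pos (by linarith) hε, ?_, ?_⟩
    · simp only [map_add, map_smul, smul_eq_mul]; linarith
    · exact hD (hCD i0 (interior_subset ho)) hwD (by linarith) t0.le (by ring)
    · have : (1 - τ) • o + τ • w + ((1 - τ) * ε) • e = (1 - τ) • (o + ε • e) + τ • w := by module
      rw [this]
      exact hD (hCD i0 hoε) hwD (by linarith) t0.le (by ring)
  have hfP : ∀ s : ℝ, f (p + s • e) = c := by intro s; simp [hfe, hpc]
  have hline : ∀ z, f z = c → ∃ s : ℝ, z = p + s • e := by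
    intro z hz
    obtain ⟨t, ht⟩ := he (z - p) (by simp [hz, hpc])
    exact ⟨t, by rw [← ht]; abel⟩
  have hPconv : ∀ (K : Set (EuclideanSpace ℝ (Fin 2))), Convex ℝ K → ∀ a b s : ℝ, p + a • e ∈ K → p + b • e ∈ K → a ≤ s →
      s ≤ b → p + s • e ∈ K := by
    intro K hK a b s ha hb h1 h2
    rcases eq_or_lt_of_le (h1.trans h2) with hab | hab
    · have : s = a := by linarith
      rwa [this]
    · have hp' : 0 < b - a := by linarith
      have := hK ha hb (a := (b - s) / (b - a)) (b := (s - a) / (b - a))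
        (div_nonneg (by linarith) hp'.le) (div_nonneg (by linarith) hp'.le)
        (by field_simp; ring)
      convert this using 1
      have e1 : (b - s) / (b - a) + (s - a) / (b - a) = 1 := by field_simp; ring
      have e2 : (b - s) / (b - a) * a + (s - a) / (b - a) * b = s := by field_simp; ring
      rw [smul_add, smul_add, smul_smul, smul_smul]
      calc p + s • e = ((b - s) / (b - a) + (s - a) / (b - a)) • p +
            ((b - s) / (b - a) * a + (s - a) / (b - a) * b) • e := by rw [e1, e2, one_smul]
        _ = _ := by rw [add_smul, add_smul]; abel
  -- slices
  set S : ι → Set ℝ := fun i => {s | p + s • e ∈ C i} with hS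
  have hScl : ∀ i, IsClosed (S i) := fun i => (hcl i).preimage (by fun_prop)
  have hSD : ∀ i, ∀ s ∈ S i, p + s • e ∈ D := fun i s hs => hCD i hs
  have hScov : ∀ s : ℝ, p + s • e ∈ D → ∃ i, s ∈ S i := by
    intro s hs
    have : p + s • e ∈ ⋃ i, C i := by rw [hcov]; exact ⟨hs, (hfP s).le⟩
    obtain ⟨i, hi⟩ := mem_iUnion.1 this
    exact ⟨i, hi⟩
  have hpig : ∀ u v : ℝ, u < v → p + u • e ∈ D → p + v • e ∈ D →
      ∃ i s t, s ∈ S i ∧ t ∈ S i ∧ u < s ∧ s < t ∧ t < v := fun u v huv hu hv =>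
    pe_pigeon S huv fun s hs => hScov s (hPconv D hD u v s hu hv hs.1.le hs.2.le)
  -- separators
  have hsep : ∀ i j, ∃ (g : (EuclideanSpace ℝ (Fin 2)) →L[ℝ] ℝ) (u : ℝ), i ≠ j → (∀ x ∈ C i, g x ≤ u) ∧
      (∀ x ∈ C j, u ≤ g x) ∧ ((S i).Nonempty → (S j).Nonempty → g e ≠ 0) := by
    intro i j
    by_cases hij : i = j
    · exact ⟨0, 0, fun h => absurd hij h⟩
    · obtain ⟨g, u, h⟩ := pe_sep hf hpc he (hcl i) (hcv i) (hne i) (hCf i) (hcl j) (hcv j) (hne j)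
        (hCf j) (hdisj i j hij)
      exact ⟨g, u, fun _ => h⟩
  choose g γ hg using hsep
  have hoverlap : ∀ i j, i ≠ j → ∀ s t, s < t → s ∈ S i → t ∈ S i → s ∈ S j → t ∈ S j → False := by
    intro i j hij s t hst h1 h2 h3 h4
    obtain ⟨ga, gb, gc⟩ := hg i j hij
    have a1 := ga _ h1
    have a2 := ga _ h2
    have a3 := gb _ h3
    have a4 := gb _ h4
    simp only [map_add, map_smul, smul_eq_mul] at a1 a2 a3 a4
    have : (t - s) * g i j e = 0 := by linarith
    rcases mul_eq_zero.1 this with h | h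
    · linarith
    · exact gc ⟨s, h1⟩ ⟨s, h3⟩ h
  -- touching cells
  set T : ι → Prop := fun i => ∃ s t, s ∈ S i ∧ t ∈ S i ∧ s < t with hT
  have hmid : ∀ i, ∃ m : ℝ, T i → ∃ s t, s ∈ S i ∧ t ∈ S i ∧ s < m ∧ m < t := by
    intro i
    by_cases h : T i
    · obtain ⟨s, t, hs, ht, hst⟩ := h
      exact ⟨(s + t) / 2, fun _ => ⟨s, t, hs, ht, by linarith, by linarith⟩⟩
    · exact ⟨0, fun h' => absurd h' h⟩
  choose m hm using hmid
  have hmS : ∀ i, T i → m i ∈ S i := by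
    intro i hi
    obtain ⟨s, t, hs, ht, h1, h2⟩ := hm i hi
    exact hPconv _ (hcv i) s t _ hs ht h1.le h2.le
  have hK : ∀ i j, i ≠ j → T j → ∀ s t, s ∈ S i → t ∈ S i → s < m j → m j < t → False := by
    intro i j hij hj s t hs ht h1 h2
    obtain ⟨s', t', hs', ht', h1', h2'⟩ := hm j hj
    have l1 : max s s' < m j := max_lt h1 h1'
    have l2 : m j < min t t' := lt_min h2 h2'
    refine hoverlap i j hij (max s s') (min t t') (l1.trans l2) ?_ ?_ ?_ ?_
    · exact hPconv _ (hcv i) s t _ hs ht (le_max_left _ _) ((l1.trans h2).le)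
    · exact hPconv _ (hcv i) s t _ hs ht ((h1.trans l2).le) (min_le_left _ _)
    · exact hPconv _ (hcv j) s' t' _ hs' ht' (le_max_right _ _) ((l1.trans h2').le)
    · exact hPconv _ (hcv j) s' t' _ hs' ht' ((h1'.trans l2).le) (min_le_right _ _)
  have hminj : ∀ i j, T i → T j → m i = m j → i = j := by
    intro i j hi hj hij
    by_contra hne'
    obtain ⟨s, t, hs, ht, h1, h2⟩ := hm i hi
    exact hK i j hne' hj s t hs ht (hij ▸ h1) (hij ▸ h2)
  set N : ι → ι → Prop := fun j l => T j ∧ T l ∧ m j < m l ∧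
    ∀ n, T n → m j < m n → m l ≤ m n with hN
  have hNuniq : ∀ j l l', N j l → N j l' → l = l' := by
    intro j l l' h h'
    exact hminj _ _ h.2.1 h'.2.1 (le_antisymm (h.2.2.2 _ h'.2.1 h'.2.2.1)
      (h'.2.2.2 _ h.2.1 h.2.2.1))
  have hNge : ∀ j l, N j l → 0 < g j l e := by
    intro j l h
    have hjl : j ≠ l := by rintro rfl; exact lt_irrefl _ h.2.2.1
    obtain ⟨ga, gb, gc⟩ := hg j l hjl
    have a1 := ga _ (hmS j h.1)
    have a2 := gb _ (hmS l h.2.1)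
    have a3 := gc ⟨_, hmS j h.1⟩ ⟨_, hmS l h.2.1⟩
    simp only [map_add, map_smul, smul_eq_mul] at a1 a2
    have h4 := h.2.2.1
    by_contra hneg
    have : g j l e < 0 := lt_of_le_of_ne (not_lt.1 hneg) a3
    nlinarith
  have hNne : ∀ j l, N j l → j ≠ l := by
    rintro j l h rfl; exact lt_irrefl _ h.2.2.1
  have hnext : ∀ i j, T i → T j → m i < m j → ∃ l, N i l := by
    intro i j hi hj hij
    obtain ⟨l, hl, hmin⟩ := Set.exists_min_image {l | T l ∧ m i < m l} m (Set.toFinite _)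
      ⟨j, hj, hij⟩
    exact ⟨l, hi, hl.1, hl.2, fun n hn hin => hmin n ⟨hn, hin⟩⟩
  have hprev : ∀ i j, T i → T j → m j < m i → ∃ l, N l i := by
    intro i j hi hj hij
    obtain ⟨l, hl, hmax⟩ := Set.exists_max_image {l | T l ∧ m l < m i} m (Set.toFinite _)
      ⟨j, hj, hij⟩
    refine ⟨l, hl.1, hi, hl.2, fun n hn hin => ?_⟩
    by_contra hlt
    exact absurd (hmax n ⟨hn, not_le.1 hlt⟩) (not_le.2 hin)
  -- the slice claim
  have hslice : ∀ i, T i → ∀ x : ℝ, p + x • e ∈ D → (∀ j, N j i → γ j i ≤ g j i (p + x • e)) →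
      (∀ l, N i l → g i l (p + x • e) ≤ γ i l) → x ∈ S i := by
    intro i hi x hxD h1 h2
    by_contra hx
    have hnh : (S i)ᶜ ∈ 𝓝 x := (hScl i).isOpen_compl.mem_nhds hx
    obtain ⟨η, hη, hball⟩ := Metric.mem_nhds_iff.1 hnh
    have hmi := hmS i hi
    have hnear : ∀ y, |y - x| < η → y ∉ S i := fun y hy => hball (by simpa [Real.dist_eq] using hy)
    have hxm : x ≠ m i := by rintro rfl; exact hx hmi
    rcases lt_or_gt_of_ne hxm with hlt | hgt
    · -- `x < m i`
      set v := min (m i) (x + η) with hv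
      have hxv : x < v := lt_min hlt (by linarith)
      have hvD : p + v • e ∈ D := hPconv D hD x (m i) v hxD (hSD i _ hmi) hxv.le (min_le_left _ _)
      obtain ⟨j, s, t, hs, ht, hus, hst, htv⟩ := hpig x v hxv hxD hvD
      have htm : t < m i := htv.trans_le (min_le_left _ _)
      have hji : j ≠ i := by
        rintro rfl
        refine hnear t ?_ ht
        rw [abs_of_pos (by linarith)]
        linarith [htv.trans_le (min_le_right (m j) (x + η))]
      have hj : T j := ⟨s, t, hs, ht, hst⟩
      have hmj : m j < m i := by
        by_contra hcon
        rcases eq_or_lt_of_le (not_lt.1 hcon) with h | h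
        · exact hji (hminj _ _ hi hj h).symm
        · exact hK j i hji hi t (m j) ht (hmS j hj) htm h
      obtain ⟨q, hq⟩ := hprev i j hi hj hmj
      have hqi := hNne _ _ hq
      have hpos := hNge _ _ hq
      have hqx : ∀ y ∈ S q, y ≤ x := by
        intro y hy
        have a1 := (hg q i hqi).1 _ hy
        have a2 := h1 q hq
        simp only [map_add, map_smul, smul_eq_mul] at a1 a2
        by_contra hcon
        nlinarith
      have hjq : j ≠ q := by
        rintro rfl
        linarith [hqx _ hs]
      have hmjq : m j ≤ m q := by
        by_contra hcon
        linarith [hq.2.2.2 j hj (not_le.1 hcon)]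
      have hmjq' : m j < m q := lt_of_le_of_ne hmjq fun h => hjq (hminj _ _ hj hq.1 h)
      exact hK j q hjq hq.1 (m j) s (hmS j hj) hs hmjq' (by linarith [hqx _ (hmS q hq.1)])
    · -- `m i < x`
      set u := max (m i) (x - η) with hu
      have hux : u < x := max_lt hgt (by linarith)
      have huD : p + u • e ∈ D := hPconv D hD (m i) x u (hSD i _ hmi) hxD (le_max_left _ _) hux.le
      obtain ⟨j, s, t, hs, ht, hus, hst, htx⟩ := hpig u x hux huD hxD
      have hsm : m i < s := (le_max_left _ _).trans_lt hus
      have hji : j ≠ i := by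
        rintro rfl
        refine hnear s ?_ hs
        rw [abs_of_neg (by linarith)]
        linarith [(le_max_right (m j) (x - η)).trans_lt hus]
      have hj : T j := ⟨s, t, hs, ht, hst⟩
      have hmj : m i < m j := by
        by_contra hcon
        rcases eq_or_lt_of_le (not_lt.1 hcon) with h | h
        · exact hji (hminj _ _ hj hi h)
        · exact hK j i hji hi (m j) s (hmS j hj) hs h hsm
      obtain ⟨n, hn⟩ := hnext i j hi hj hmj
      have hin := hNne _ _ hn
      have hpos := hNge _ _ hn
      have hnx : ∀ y ∈ S n, x ≤ y := by
        intro y hy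
        have a1 := (hg i n hin).2.1 _ hy
        have a2 := h2 n hn
        simp only [map_add, map_smul, smul_eq_mul] at a1 a2
        by_contra hcon
        nlinarith
      have hjn : j ≠ n := by
        rintro rfl
        linarith [hnx _ hs]
      have hmjn : m n < m j := lt_of_le_of_ne (hn.2.2.2 j hj hmj)
        fun h => hjn (hminj _ _ hn.2.1 hj h).symm
      exact hK j n hjn hn.2.1 s (m j) hs (hmS j hj) (by linarith [hnx _ (hmS n hn.2.1)]) hmjn
  -- the upper cells
  set A : ι → Set (EuclideanSpace ℝ (Fin 2)) := fun i => {z | T i ∧ z ∈ D ∧ c ≤ f z ∧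
    (∀ j l, N j l → m j < m i → γ j l ≤ g j l z) ∧ ∀ l, N i l → g i l z ≤ γ i l} with hA
  have hAcl : ∀ i, IsClosed (A i) := by
    intro i
    by_cases hi : T i
    · have : A i = D ∩ ({z | c ≤ f z} ∩ ((⋂ j, ⋂ l, ⋂ (_ : N j l), ⋂ (_ : m j < m i),
          {z | γ j l ≤ g j l z}) ∩ ⋂ l, ⋂ (_ : N i l), {z | g i l z ≤ γ i l})) := by
        ext z
        simp only [hA, hi, true_and, mem_ofPred_eq, mem_inter_iff, mem_iInter]
      rw [this]
      refine hDcl.inter ((isClosed_le continuous_const f.continuous).inter (IsClosed.inter ?_ ?_))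
      · exact isClosed_iInter fun j => isClosed_iInter fun l => isClosed_iInter fun _ =>
          isClosed_iInter fun _ => isClosed_le continuous_const (g j l).continuous
      · exact isClosed_iInter fun l => isClosed_iInter fun _ =>
          isClosed_le (g i l).continuous continuous_const
    · have : A i = ∅ := by
        ext z
        simp [hA, hi]
      rw [this]
      exact isClosed_empty
  have hAcv : ∀ i, Convex ℝ (A i) := by
    rintro i x ⟨hx0, hx1, hx2, hx3, hx4⟩ y ⟨-, hy1, hy2, hy3, hy4⟩ a b ha hb hab
    refine ⟨hx0, hD hx1 hy1 ha hb hab, ?_, ?_, ?_⟩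
    · simp only [map_add, map_smul, smul_eq_mul]
      have : c = a * c + b * c := by rw [← add_mul, hab, one_mul]
      rw [this]
      gcongr
    · intro j l h h'
      simp only [map_add, map_smul, smul_eq_mul]
      have : γ j l = a * γ j l + b * γ j l := by rw [← add_mul, hab, one_mul]
      rw [this]
      have := hx3 j l h h'
      have := hy3 j l h h'
      gcongr
    · intro l h
      simp only [map_add, map_smul, smul_eq_mul]
      have : γ i l = a * γ i l + b * γ i l := by rw [← add_mul, hab, one_mul]
      rw [this]
      have := hx4 l h
      have := hy4 l h
      gcongr
  have hCA : ∀ i, T i → ∀ z ∈ C i, f z = c → z ∈ A i := by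
    intro i hi z hz hzc
    obtain ⟨x, rfl⟩ := hline z hzc
    refine ⟨hi, hCD i hz, hzc.ge, ?_, ?_⟩
    · intro j l hjl hji
      have hli := hjl.2.2.2 i hi hji
      by_cases hl : l = i
      · subst hl
        exact (hg j l (hNne _ _ hjl)).2.1 _ hz
      · have hlt : m l < m i := lt_of_le_of_ne hli fun h => hl (hminj _ _ hjl.2.1 hi h)
        have hx : m l ≤ x := by
          by_contra hcon
          exact hK i l (Ne.symm hl) hjl.2.1 x (m i) hz (hmS i hi) (not_le.1 hcon) hlt
        have a1 := (hg j l (hNne _ _ hjl)).2.1 _ (hmS l hjl.2.1)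
        have hpos := hNge _ _ hjl
        simp only [map_add, map_smul, smul_eq_mul] at a1 ⊢
        nlinarith
    · intro l hil
      exact (hg i l (hNne _ _ hil)).1 _ hz
  refine ⟨fun i => C i ∪ A i, fun i => (hcl i).union (hAcl i), ?_, ?_, ?_,
    fun i => subset_union_left⟩
  · intro i
    refine pe_convex_union (hcv i) (hAcv i) (hCf i) (fun x hx => hx.2.2.1) ?_
    intro u hu w' hw' z hz hzc
    have hi := hw'.1
    have hzC : z ∈ C i := by
      have hzD : z ∈ D := hD.segment_subset (hCD i hu) hw'.2.1 hz
      have c1 : ∀ j, N j i → γ j i ≤ g j i z := by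
        intro j hj
        have hc' : Convex ℝ {z | γ j i ≤ g j i z} :=
          convex_halfSpace_ge (g j i).toLinearMap.isLinear _
        exact hc'.segment_subset ((hg j i (hNne _ _ hj)).2.1 _ hu) (hw'.2.2.2.1 j i hj hj.2.2.1) hz
      have c2 : ∀ l, N i l → g i l z ≤ γ i l := by
        intro l hl
        have hc' : Convex ℝ {z | g i l z ≤ γ i l} :=
          convex_halfSpace_le (g i l).toLinearMap.isLinear _
        exact hc'.segment_subset ((hg i l (hNne _ _ hl)).1 _ hu) (hw'.2.2.2.2 l hl) hz
      obtain ⟨x, rfl⟩ := hline z hzc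
      exact hslice i hi x hzD c1 c2
    exact ⟨hzC, hCA i hi z hzC hzc⟩
  · apply Subset.antisymm
    · exact iUnion_subset fun i => union_subset (hCD i) fun z hz => hz.2.1
    · intro z hz
      rcases le_total (f z) c with hzc | hzc
      · have : z ∈ ⋃ i, C i := by rw [hcov]; exact ⟨hz, hzc⟩
        obtain ⟨i, hi⟩ := mem_iUnion.1 this
        exact mem_iUnion.2 ⟨i, Or.inl hi⟩
      · have hTne : {i | T i}.Nonempty := by
          obtain ⟨j, s, t, hs, ht, -, hst, -⟩ := hpig 0 δ hδ (by simpa using hpD) hpδ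
          exact ⟨j, s, t, hs, ht, hst⟩
        obtain ⟨last, hlast, hmax⟩ := Set.exists_max_image {i | T i} m (Set.toFinite _) hTne
        obtain ⟨i, hi, hmin⟩ := Set.exists_min_image
          {i | T i ∧ ∀ l, N i l → g i l z ≤ γ i l} m (Set.toFinite _)
          ⟨last, hlast, fun l hl => absurd hl.2.2.1 (not_lt.2 (hmax l hl.2.1))⟩
        refine mem_iUnion.2 ⟨i, Or.inr ⟨hi.1, hz, hzc, ?_, hi.2⟩⟩
        intro j l hjl hji
        by_contra hcon
        have := hmin j ⟨hjl.1, fun l' hl' => by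
          rw [hNuniq j l' l hl' hjl]; exact (not_le.1 hcon).le⟩
        linarith
  · -- disjointness
    have main : ∀ i j, T i → T j → m i < m j → ∀ U : Set (EuclideanSpace ℝ (Fin 2)), IsOpen U → U.Nonempty →
        U ⊆ A i → U ⊆ A j → False := by
      intro i j hi hj hij U hU hUne h1 h2
      obtain ⟨l, hl⟩ := hnext i j hi hj hij
      obtain ⟨x, hx⟩ := hUne
      have hgne : g i l ≠ 0 := by
        intro h
        have := hNge _ _ hl
        simp [h] at this
      have hx' : x ∈ interior U := by rwa [hU.interior_eq]
      have a1 := pe_lt hgne (fun y hy => (h1 hy).2.2.2.2 l hl) hx'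
      have a2 := (h2 hx).2.2.2.1 i l hl hij
      linarith
    intro i j hij
    by_contra hne'
    obtain ⟨x, hxi, hxj⟩ := Set.nonempty_iff_ne_empty.2 hne'
    set U := interior (C i ∪ A i) ∩ interior (C j ∪ A j) with hU
    have hUo : IsOpen U := isOpen_interior.inter isOpen_interior
    by_cases hlow : ∃ y ∈ U, f y < c
    · obtain ⟨y, hy, hyc⟩ := hlow
      have hW : IsOpen (U ∩ {y | f y < c}) :=
        hUo.inter (isOpen_lt f.continuous continuous_const)
      have w1 : U ∩ {y | f y < c} ⊆ C i := by
        rintro y ⟨hy, hyc⟩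
        rcases interior_subset hy.1 with h | h
        · exact h
        · exact absurd h.2.2.1 (not_le.2 hyc)
      have w2 : U ∩ {y | f y < c} ⊆ C j := by
        rintro y ⟨hy, hyc⟩
        rcases interior_subset hy.2 with h | h
        · exact h
        · exact absurd h.2.2.1 (not_le.2 hyc)
      have : y ∈ interior (C i) ∩ interior (C j) :=
        ⟨interior_maximal w1 hW ⟨hy, hyc⟩, interior_maximal w2 hW ⟨hy, hyc⟩⟩
      rw [hdisj i j hij] at this
      exact this
    · push Not at hlow
      have hxU : x ∈ U := ⟨hxi, hxj⟩
      have hxc : c < f x := by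
        have := pe_lt (f := -f) (c := -c) (neg_ne_zero.2 hf) (C := U)
          (fun y hy => by simpa using hlow y hy) (o := x) (by rwa [hUo.interior_eq])
        simpa using this
      have hW : IsOpen (U ∩ {y | c < f y}) :=
        hUo.inter (isOpen_lt continuous_const f.continuous)
      have w1 : U ∩ {y | c < f y} ⊆ A i := by
        rintro y ⟨hy, hyc⟩
        rcases interior_subset hy.1 with h | h
        · exact absurd (hCf i y h) (not_le.2 hyc)
        · exact h
      have w2 : U ∩ {y | c < f y} ⊆ A j := by
        rintro y ⟨hy, hyc⟩
        rcases interior_subset hy.2 with h | h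
        · exact absurd (hCf j y h) (not_le.2 hyc)
        · exact h
      have hi : T i := (w1 ⟨hxU, hxc⟩).1
      have hj : T j := (w2 ⟨hxU, hxc⟩).1
      rcases lt_trichotomy (m i) (m j) with h | h | h
      · exact main i j hi hj h _ hW ⟨x, hxU, hxc⟩ w1 w2
      · exact hij (hminj _ _ hi hj h)
      · exact main j i hj hi h _ hW ⟨x, hxU, hxc⟩ w2 w1

/-- Extension from a polygon (finite intersection of half-planes) to the plane. -/
lemma pe_polygon {ι κ : Type*} [Finite ι] [Nonempty ι] (f : κ → (EuclideanSpace ℝ (Fin 2)) →L[ℝ] ℝ) (c : κ → ℝ)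
    (s : Finset κ) : ∀ (C : ι → Set (EuclideanSpace ℝ (Fin 2))),
    (∀ i, IsClosed (C i)) → (∀ i, Convex ℝ (C i)) → (∀ i, (interior (C i)).Nonempty) →
    (⋃ i, C i) = {x | ∀ a ∈ s, f a x ≤ c a} →
    (∀ i j, i ≠ j → interior (C i) ∩ interior (C j) = ∅) →
    ∃ V : ι → Set (EuclideanSpace ℝ (Fin 2)), (∀ i, IsClosed (V i)) ∧ (∀ i, Convex ℝ (V i)) ∧ (⋃ i, V i) = univ ∧
      (∀ i j, i ≠ j → interior (V i) ∩ interior (V j) = ∅) ∧ ∀ i, C i ⊆ V i := by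
  classical
  induction s using Finset.induction_on with
  | empty =>
    intro C h1 h2 h3 h4 h5
    exact ⟨C, h1, h2, by simpa using h4, h5, fun i => subset_rfl⟩
  | insert a s ha ih =>
    intro C h1 h2 h3 h4 h5
    have hset : {x : (EuclideanSpace ℝ (Fin 2)) | ∀ b ∈ s, f b x ≤ c b} = ⋂ b ∈ s, {x | f b x ≤ c b} := by
      ext x; simp
    obtain ⟨V, v1, v2, v3, v4, v5⟩ := pe_step (D := {x | ∀ b ∈ s, f b x ≤ c b})
      (by rw [hset]; exact isClosed_biInter fun b _ => isClosed_le (f b).continuous continuous_const)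
      (by rw [hset]; exact convex_iInter₂ fun b _ =>
            convex_halfSpace_le (f b).toLinearMap.isLinear _)
      (f a) (c a) C h1 h2 h3
      (by rw [h4]; ext x; simp [and_comm]) h5
    obtain ⟨W, w1, w2, w3, w4, w5⟩ := ih V v1 v2 (fun i => (h3 i).mono (interior_mono (v5 i))) v3 v4
    exact ⟨W, w1, w2, w3, w4, fun i => (v5 i).trans (w5 i)⟩

/-- A polygon squeezed between a compact convex subset of the interior and the body. -/
lemma pe_approx {B K : Set (EuclideanSpace ℝ (Fin 2))} (hB : IsCompact B) (hK : Convex ℝ K) (hKc : IsCompact K)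
    (hKne : K.Nonempty) (hKB : K ⊆ interior B) :
    ∃ s : Finset (((EuclideanSpace ℝ (Fin 2)) →L[ℝ] ℝ) × ℝ), K ⊆ interior {x | ∀ a ∈ s, a.1 x ≤ a.2} ∧
      {x | ∀ a ∈ s, a.1 x ≤ a.2} ⊆ B := by
  classical
  have hfr : IsCompact (frontier B) := hB.of_isClosed_subset isClosed_frontier
    hB.isClosed.frontier_subset
  have hsepn : ∀ y : (EuclideanSpace ℝ (Fin 2)), ∃ a : ((EuclideanSpace ℝ (Fin 2)) →L[ℝ] ℝ) × ℝ, y ∈ frontier B →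
      (∀ x ∈ K, a.1 x < a.2) ∧ a.2 < a.1 y := by
    intro y
    by_cases hy : y ∈ frontier B
    · have : y ∉ K := fun h => hy.2 (hKB h)
      obtain ⟨g, u, h1, h2⟩ := geometric_hahn_banach_closed_point hK hKc.isClosed this
      exact ⟨(g, u), fun _ => ⟨h1, h2⟩⟩
    · exact ⟨0, fun h => absurd h hy⟩
  choose a ha using hsepn
  obtain ⟨t, ht, hcov⟩ := hfr.elim_nhds_subcover (fun y => {x | (a y).2 < (a y).1 x})
    (fun y hy => (isOpen_lt continuous_const (a y).1.continuous).mem_nhds (ha y hy).2)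
  refine ⟨t.image a, ?_, ?_⟩
  · have hop : IsOpen (⋂ y ∈ t, {x : (EuclideanSpace ℝ (Fin 2)) | (a y).1 x < (a y).2}) :=
      isOpen_biInter_finset fun y _ => isOpen_lt (a y).1.continuous continuous_const
    refine Subset.trans ?_ (interior_maximal (s := {x | ∀ b ∈ t.image a, b.1 x ≤ b.2}) ?_ hop)
    · intro x hx
      simp only [mem_iInter]
      exact fun y hy => (ha y (ht y hy)).1 x hx
    · intro x hx
      simp only [mem_iInter, mem_ofPred_eq] at hx
      simp only [Finset.mem_image, mem_ofPred_eq]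
      rintro b ⟨y, hy, rfl⟩
      exact (hx y hy).le
  · have hset : {x : (EuclideanSpace ℝ (Fin 2)) | ∀ b ∈ t.image a, b.1 x ≤ b.2} = ⋂ y ∈ t, {x | (a y).1 x ≤ (a y).2} := by
      ext x; simp
    rw [hset]
    set Q := ⋂ y ∈ t, {x : (EuclideanSpace ℝ (Fin 2)) | (a y).1 x ≤ (a y).2} with hQ
    have hQc : Convex ℝ Q := convex_iInter₂ fun b _ =>
      convex_halfSpace_le (a b).1.toLinearMap.isLinear _
    intro q hq
    by_contra hqB
    obtain ⟨o, ho⟩ := hKne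
    have hoQ : o ∈ Q := by
      simp only [hQ, mem_iInter]
      exact fun y hy => ((ha y (ht y hy)).1 o ho).le
    have hQf : ∀ x ∈ Q, x ∉ frontier B := by
      intro x hx hxf
      obtain ⟨y, hy, hxy⟩ := mem_iUnion₂.1 (hcov hxf)
      simp only [hQ, mem_iInter] at hx
      have h1 : (a y).1 x ≤ (a y).2 := hx y hy
      have h2 : (a y).2 < (a y).1 x := hxy
      linarith
    obtain ⟨x, -, h1, h2⟩ := hQc.isPreconnected (interior B) Bᶜ isOpen_interior
      hB.isClosed.isOpen_compl (fun x hx => by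
        by_cases h : x ∈ interior B
        · exact Or.inl h
        · refine Or.inr fun hxB => hQf x hx ⟨subset_closure hxB, h⟩) ⟨o, hoQ, hKB ho⟩ ⟨q, hq, hqB⟩
    exact h2 (interior_subset h1)

/-- The theorem for cells with nonempty interior. -/
lemma pe_fat {ι : Type*} [Finite ι] [Nonempty ι] {B : Set (EuclideanSpace ℝ (Fin 2))} (hBconv : Convex ℝ B)
    (hB : IsCompact B) (C : ι → Set (EuclideanSpace ℝ (Fin 2)))
    (hcl : ∀ i, IsClosed (C i)) (hcv : ∀ i, Convex ℝ (C i)) (hne : ∀ i, (interior (C i)).Nonempty)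
    (hcov : (⋃ i, C i) = B)
    (hdisj : ∀ i j, i ≠ j → interior (C i) ∩ interior (C j) = ∅) :
    ∃ V : ι → Set (EuclideanSpace ℝ (Fin 2)), (∀ i, IsClosed (V i)) ∧ (∀ i, Convex ℝ (V i)) ∧ (⋃ i, V i) = univ ∧
      (∀ i j, i ≠ j → interior (V i) ∩ interior (V j) = ∅) ∧ ∀ i, C i ⊆ V i := by
  classical
  have hCB : ∀ i, C i ⊆ B := fun i => hcov ▸ subset_iUnion C i
  choose o ho using hne
  have hoB : ∀ i, o i ∈ interior B := fun i => interior_mono (hCB i) (ho i)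
  -- one extension for every finite set of interior points
  have hex : ∀ F : Finset (interior B), ∃ V : ι → Set (EuclideanSpace ℝ (Fin 2)), (∀ i, IsClosed (V i)) ∧
      (∀ i, Convex ℝ (V i)) ∧ (⋃ i, V i) = univ ∧
      (∀ i j, i ≠ j → interior (V i) ∩ interior (V j) = ∅) ∧
      ∀ i, ∀ x ∈ F, (x : (EuclideanSpace ℝ (Fin 2))) ∈ C i → (x : (EuclideanSpace ℝ (Fin 2))) ∈ V i := by
    intro F
    set G : Set (EuclideanSpace ℝ (Fin 2)) := range o ∪ (Subtype.val '' (F : Set (interior B))) with hG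
    have hGf : G.Finite := (Set.finite_range o).union (F.finite_toSet.image _)
    have hGB : G ⊆ interior B := by
      rintro x (⟨i, rfl⟩ | ⟨y, -, rfl⟩)
      · exact hoB i
      · exact y.2
    obtain ⟨s, hs1, hs2⟩ := pe_approx hB (convex_convexHull ℝ G) (hGf.isCompact_convexHull ℝ)
      ((range_nonempty o).mono (subset_union_left.trans (subset_convexHull ℝ G)))
      (convexHull_min hGB hBconv.interior)
    set Q := {x : (EuclideanSpace ℝ (Fin 2)) | ∀ a ∈ s, a.1 x ≤ a.2} with hQ
    have hset : Q = ⋂ a ∈ s, {x : (EuclideanSpace ℝ (Fin 2)) | a.1 x ≤ a.2} := by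
      ext x; simp [hQ]
    have hQcl : IsClosed Q := by
      rw [hset]; exact isClosed_biInter fun b _ => isClosed_le b.1.continuous continuous_const
    have hQcv : Convex ℝ Q := by
      rw [hset]; exact convex_iInter₂ fun b _ => convex_halfSpace_le b.1.toLinearMap.isLinear _
    have hGQ : G ⊆ interior Q := (subset_convexHull ℝ G).trans hs1
    obtain ⟨V, v1, v2, v3, v4, v5⟩ := pe_polygon (ι := ι)
      (fun a : ((EuclideanSpace ℝ (Fin 2)) →L[ℝ] ℝ) × ℝ => a.1) (fun a => a.2) s (fun i => C i ∩ Q)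
      (fun i => (hcl i).inter hQcl) (fun i => (hcv i).inter hQcv)
      (fun i => ⟨o i, by rw [interior_inter]; exact ⟨ho i, hGQ (Or.inl ⟨i, rfl⟩)⟩⟩)
      (by rw [← iUnion_inter, hcov]; exact inter_eq_right.2 hs2)
      (fun i j hij => by
        refine Set.eq_empty_of_subset_empty ?_
        rw [← hdisj i j hij]
        exact inter_subset_inter (interior_mono inter_subset_left)
          (interior_mono inter_subset_left))
    refine ⟨V, v1, v2, v3, v4, fun i x hx hxC => v5 i ⟨hxC, ?_⟩⟩
    exact interior_subset (hGQ (Or.inr ⟨x, hx, rfl⟩))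
  choose V v1 v2 v3 v4 v5 using hex
  let U : Ultrafilter (Finset (interior B)) := Ultrafilter.of atTop
  have hU : (U : Filter (Finset (interior B))) ≤ atTop := Ultrafilter.of_le _
  set A : ι → Set (EuclideanSpace ℝ (Fin 2)) := fun i => {x | ∀ᶠ F in (U : Filter (Finset (interior B))), x ∈ V F i}
    with hA
  have hAcv : ∀ i, Convex ℝ (A i) := by
    intro i x hx y hy a b ha hb hab
    filter_upwards [hx, hy] with F h1 h2
    exact v2 F i h1 h2 ha hb hab
  have hCA : ∀ i, interior (C i) ⊆ A i := by
    intro i x hx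
    have hxB : x ∈ interior B := interior_mono (hCB i) hx
    have : ∀ᶠ F in (U : Filter (Finset (interior B))), (⟨x, hxB⟩ : interior B) ∈ F := by
      apply hU
      filter_upwards [eventually_ge_atTop {(⟨x, hxB⟩ : interior B)}] with F hF
      exact hF (Finset.mem_singleton_self _)
    filter_upwards [this] with F hF
    exact v5 F i _ hF (interior_subset hx)
  have hAne : ∀ i, (interior (A i)).Nonempty := fun i =>
    ⟨o i, interior_maximal (hCA i) isOpen_interior (ho i)⟩
  refine ⟨fun i => closure (A i), fun i => isClosed_closure, fun i => (hAcv i).closure, ?_, ?_, ?_⟩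
  · refine eq_univ_of_forall fun x => ?_
    have : ∀ᶠ F in (U : Filter (Finset (interior B))), ∃ i, x ∈ V F i :=
      Eventually.of_forall fun F => by
        have : x ∈ ⋃ i, V F i := by rw [v3 F]; trivial
        exact mem_iUnion.1 this
    obtain ⟨i, hi⟩ := Ultrafilter.eventually_exists_iff.1 this
    exact mem_iUnion.2 ⟨i, subset_closure hi⟩
  · intro i j hij
    rw [(hAcv i).interior_closure_eq_interior_of_nonempty_interior (hAne i),
      (hAcv j).interior_closure_eq_interior_of_nonempty_interior (hAne j)]
    by_contra hne'
    obtain ⟨x, hx⟩ := Set.nonempty_iff_ne_empty.2 hne'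
    obtain ⟨b, hb1, hb2⟩ := exists_mem_interior_convexHull_affineBasis
      ((isOpen_interior.inter isOpen_interior).mem_nhds hx)
    have hbm : ∀ n, b n ∈ A i ∧ b n ∈ A j := fun n => by
      have := hb2 (subset_convexHull ℝ _ (mem_range_self n))
      exact ⟨interior_subset this.1, interior_subset this.2⟩
    have hev : ∀ᶠ F in (U : Filter (Finset (interior B))), ∀ n, b n ∈ V F i ∧ b n ∈ V F j :=
      eventually_all.2 fun n => (hbm n).1.and (hbm n).2
    obtain ⟨F, hF⟩ := hev.exists
    have s1 : convexHull ℝ (range b) ⊆ V F i :=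
      convexHull_min (range_subset_iff.2 fun n => (hF n).1) (v2 F i)
    have s2 : convexHull ℝ (range b) ⊆ V F j :=
      convexHull_min (range_subset_iff.2 fun n => (hF n).2) (v2 F j)
    have : x ∈ interior (V F i) ∩ interior (V F j) := ⟨interior_mono s1 hb1, interior_mono s2 hb1⟩
    rw [v4 F i j hij] at this
    exact this
  · intro i
    rw [← pe_closure (hcl i) (hcv i) ⟨o i, ho i⟩]
    exact closure_mono (hCA i)

/-- A finite union of closed sets with empty interior has empty interior. -/
lemma pe_thin {ι : Type*} (s : Finset ι) (C : ι → Set (EuclideanSpace ℝ (Fin 2))) (hcl : ∀ i ∈ s, IsClosed (C i))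
    (he : ∀ i ∈ s, interior (C i) = ∅) : interior (⋃ i ∈ s, C i) = ∅ := by
  classical
  induction s using Finset.induction_on with
  | empty => simp
  | insert a s ha ih =>
    rw [Finset.set_biUnion_insert, interior_union_isClosed_of_interior_empty (hcl a (by simp)),
      he a (by simp)]
    exact ih (fun i hi => hcl i (by simp [hi])) fun i hi => he i (by simp [hi])

theorem partition_extension_plane (k : ℕ) (B : Set (EuclideanSpace ℝ (Fin 2)))
    (hBconv : Convex ℝ B) (hBcomp : IsCompact B) (hBint : (interior B).Nonempty)
    (C : Fin k → Set (EuclideanSpace ℝ (Fin 2)))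
    (hCcl : ∀ i, IsClosed (C i)) (hCconv : ∀ i, Convex ℝ (C i))
    (hCcover : (⋃ i, C i) = B)
    (hCdisj : ∀ i j, i ≠ j → interior (C i) ∩ interior (C j) = ∅) :
    ∃ V : Fin k → Set (EuclideanSpace ℝ (Fin 2)),
      (∀ i, IsClosed (V i)) ∧ (∀ i, Convex ℝ (V i)) ∧
      (⋃ i, V i) = Set.univ ∧
      (∀ i j, i ≠ j → interior (V i) ∩ interior (V j) = ∅) ∧
      (∀ i, V i ∩ B = C i) := by
  classical
  have hCB : ∀ i, C i ⊆ B := fun i => hCcover ▸ subset_iUnion C i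
  -- the fat cells cover `B`
  let J := {i : Fin k // (interior (C i)).Nonempty}
  have hJcl : IsClosed (⋃ i : J, C i) := isClosed_iUnion_of_finite fun i => hCcl i
  have hJ : (⋃ i : J, C i) = B := by
    refine Subset.antisymm (iUnion_subset fun i : J => hCB i) ?_
    have h1 : interior B ⊆ ⋃ i : J, C i := by
      by_contra hcon
      obtain ⟨x, hx, hx'⟩ := Set.not_subset.1 hcon
      have hthin := pe_thin (Finset.univ.filter fun i => ¬ (interior (C i)).Nonempty) C
        (fun i _ => hCcl i) (fun i hi => by
          simpa [Set.not_nonempty_iff_eq_empty] using hi)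
      have hsub : interior B \ (⋃ i : J, C i) ⊆
          ⋃ i ∈ Finset.univ.filter fun i => ¬ (interior (C i)).Nonempty, C i := by
        rintro y ⟨hy, hy'⟩
        have hyB : y ∈ ⋃ i, C i := by rw [hCcover]; exact interior_subset hy
        obtain ⟨i, hi⟩ := mem_iUnion.1 hyB
        refine mem_iUnion₂.2 ⟨i, ?_, hi⟩
        simp only [Finset.mem_filter, Finset.mem_univ, true_and]
        exact fun h => hy' (mem_iUnion.2 ⟨⟨i, h⟩, hi⟩)
      have := interior_maximal hsub (isOpen_interior.sdiff hJcl) ⟨hx, hx'⟩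
      rw [hthin] at this
      exact this
    calc B = closure (interior B) := (pe_closure hBcomp.isClosed hBconv hBint).symm
      _ ⊆ _ := closure_minimal h1 hJcl
  have hJne : Nonempty J := by
    obtain ⟨x, hx⟩ := hBint
    have : x ∈ ⋃ i : J, C i := by rw [hJ]; exact interior_subset hx
    obtain ⟨i, -⟩ := mem_iUnion.1 this
    exact ⟨i⟩
  obtain ⟨W, w1, w2, w3, w4, w5⟩ := pe_fat hBconv hBcomp (fun i : J => C i) (fun i => hCcl i)
    (fun i => hCconv i) (fun i => i.2) hJ
    (fun i j hij => hCdisj i j fun h => hij (Subtype.ext h))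
  have hWB : ∀ i : J, W i ∩ B = C i := by
    intro i
    apply Subset.antisymm ?_ (subset_inter (w5 i) (hCB i))
    have hcv := (w2 i).inter hBconv
    have hcl := (w1 i).inter hBcomp.isClosed
    have hne : (interior (W i ∩ B)).Nonempty :=
      i.2.mono (interior_mono (subset_inter (w5 i) (hCB i)))
    rw [← pe_closure hcl hcv hne]
    refine closure_minimal ?_ (hCcl i)
    intro y hy
    have hyB : y ∈ ⋃ i : J, C i := by rw [hJ]; exact (interior_subset hy).2
    obtain ⟨j, hj⟩ := mem_iUnion.1 hyB
    by_cases hij : i = j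
    · rw [hij]; exact hj
    · exfalso
      rw [← pe_closure (hCcl j) (hCconv j) j.2] at hj
      obtain ⟨z, hz1, hz2⟩ := mem_closure_iff.1 hj _ isOpen_interior
        (interior_mono inter_subset_left hy)
      have : z ∈ interior (W i) ∩ interior (W j) := ⟨hz1, interior_mono (w5 j) hz2⟩
      rw [w4 i j hij] at this
      exact this
  refine ⟨fun i => if h : (interior (C i)).Nonempty then W ⟨i, h⟩ else C i, ?_, ?_, ?_, ?_, ?_⟩
  · intro i
    by_cases h : (interior (C i)).Nonempty
    · simpa [h] using w1 ⟨i, h⟩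
    · simpa [h] using hCcl i
  · intro i
    by_cases h : (interior (C i)).Nonempty
    · simpa [h] using w2 ⟨i, h⟩
    · simpa [h] using hCconv i
  · refine eq_univ_of_forall fun x => ?_
    have : x ∈ ⋃ i, W i := by rw [w3]; trivial
    obtain ⟨i, hi⟩ := mem_iUnion.1 this
    refine mem_iUnion.2 ⟨i, ?_⟩
    rw [dif_pos i.2]
    exact hi
  · intro i j hij
    by_cases h : (interior (C i)).Nonempty
    · by_cases h' : (interior (C j)).Nonempty
      · simp only [h, h', dite_true]
        exact w4 _ _ fun he => hij (congrArg Subtype.val he)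
      · simp only [h', dite_false]
        rw [Set.not_nonempty_iff_eq_empty.1 h', inter_empty]
    · simp only [h, dite_false]
      rw [Set.not_nonempty_iff_eq_empty.1 h, empty_inter]
  · intro i
    by_cases h : (interior (C i)).Nonempty
    · simp only [h, dite_true]
      exact hWB ⟨i, h⟩
    · simp only [h, dite_false]
      exact inter_eq_left.2 (hCB i)
end
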